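/- arXiv:2308.11586 — 2 statements merged into one kernel-verified Lean document; each statement's English description precedes it below -/
import Mathlib

section
/- Let X = (⊕_{n∈ℕ} ℓ₂ⁿ)_{ℓ₁} and let G denote the closure in B(X), with respect to the operator norm, of the set of operators that factor through ℓ₁, i.e., of {U∘V : V ∈ B(X, ℓ₁), U ∈ B(ℓ₁, X)}. Then for every constant C > 1 and every operator T ∈ B(X) with T ∉ G and dist(T, G) = 1, there exist operators U, V ∈ B(X) such that U∘T∘V = I_X and ‖U‖·‖V‖ ≤ C. -/
open scoped ENNReal

namespace EllOneSum

section EllOne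

variable {𝕜 : Type*} [RCLike 𝕜]
  {Y : Type*} [NormedAddCommGroup Y] [NormedSpace 𝕜 Y]
  {H : Type*} [NormedAddCommGroup H] [NormedSpace 𝕜 H]

lemma hasSum_norm_coord {ι : Type*} {E : ι → Type*} [∀ i, NormedAddCommGroup (E i)]
    (x : lp E 1) : HasSum (fun i => ‖x i‖) ‖x‖ := by
  simpa using lp.hasSum_norm (p := 1) (by simp) x

lemma opNorm_le_of_single {ι : Type*} [DecidableEq ι] {E : ι → Type*}
    [∀ i, NormedAddCommGroup (E i)] [∀ i, NormedSpace 𝕜 (E i)] {C : ℝ} (hC : 0 ≤ C)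
    (D : lp E 1 →L[𝕜] Y) (h : ∀ i x, ‖D (lp.single 1 i x)‖ ≤ C * ‖x‖) : ‖D‖ ≤ C := by
  refine D.opNorm_le_bound hC fun x => ?_
  have h1 := (lp.hasSum_single (p := 1) (by simp) x).mapL D
  have h2 := (hasSum_norm_coord x).mul_left C
  rw [← h1.tsum_eq]
  exact tsum_of_norm_bounded h2 fun i => h i _

/-- The universal property of an `ℓ₁`-sum. -/
lemma exists_desc {ι : Type*} [DecidableEq ι] {E : ι → Type*} [∀ i, NormedAddCommGroup (E i)]
    [∀ i, NormedSpace 𝕜 (E i)] [CompleteSpace Y] {C : ℝ} (hC : 0 ≤ C) (f : ∀ i, E i →L[𝕜] Y)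
    (hf : ∀ i, ‖f i‖ ≤ C) :
    ∃ D : lp E 1 →L[𝕜] Y, ‖D‖ ≤ C ∧ (∀ i x, D (lp.single 1 i x) = f i x) ∧
      ∀ x, HasSum (fun i => f i (x i)) (D x) := by
  have hb : ∀ (x : lp E 1) i, ‖f i (x i)‖ ≤ C * ‖x i‖ := fun x i =>
    (f i).le_of_opNorm_le (hf i) _
  have hs : ∀ x : lp E 1, Summable fun i => f i (x i) := fun x =>
    Summable.of_norm_bounded ((hasSum_norm_coord x).summable.mul_left C) (hb x)
  let D : lp E 1 →L[𝕜] Y := LinearMap.mkContinuous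
    { toFun := fun x => ∑' i, f i (x i)
      map_add' := fun x y => by
        rw [← (hs x).tsum_add (hs y)]
        simp
      map_smul' := fun c x => by
        rw [RingHom.id_apply, ← (hs x).tsum_const_smul c]
        simp } C
    (fun x => tsum_of_norm_bounded ((hasSum_norm_coord x).mul_left C) (hb x))
  refine ⟨D, LinearMap.mkContinuous_norm_le _ hC _, fun i x => ?_, fun x => (hs x).hasSum⟩
  change ∑' j, f j ((lp.single 1 i x : lp E 1) j) = f i x
  rw [tsum_eq_single i fun j hj => by rw [lp.single_apply_ne _ _ _ hj, map_zero],
    lp.single_apply_self]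

/-- `S` factors through `ℓ₁` with constant at most `M`. -/
def FactorsThroughEllOne (M : ℝ) (S : H →L[𝕜] Y) : Prop :=
  ∃ (V : H →L[𝕜] lp (fun _ : ℕ => 𝕜) 1) (U : lp (fun _ : ℕ => 𝕜) 1 →L[𝕜] Y),
    ‖V‖ ≤ M ∧ ‖U‖ ≤ 1 ∧ S = U ∘L V

namespace FactorsThroughEllOne

lemma of_index {ι : Type*} [Countable ι] [CompleteSpace Y] {M : ℝ}
    (V : H →L[𝕜] lp (fun _ : ι => 𝕜) 1) (U : lp (fun _ : ι => 𝕜) 1 →L[𝕜] Y) (hV : ‖V‖ ≤ M)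
    (hU : ‖U‖ ≤ 1) :
    FactorsThroughEllOne M (U ∘L V) := by
  classical
  obtain ⟨e, he⟩ := exists_injective_nat ι
  obtain ⟨A, hA, hA', -⟩ := exists_desc (E := fun _ : ι => 𝕜) zero_le_one
    (fun i => lp.singleContinuousLinearMap 𝕜 (fun _ : ℕ => 𝕜) 1 (e i))
    (fun i => ContinuousLinearMap.opNorm_le_bound _ zero_le_one fun x => by simp)
  obtain ⟨B, hB, hB', -⟩ := exists_desc (E := fun _ : ℕ => 𝕜) (Y := lp (fun _ : ι => 𝕜) 1)
    zero_le_one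
    (fun n => if h : ∃ i, e i = n then
      lp.singleContinuousLinearMap 𝕜 (fun _ : ι => 𝕜) 1 h.choose else 0)
    (fun n => by
      split_ifs
      · exact ContinuousLinearMap.opNorm_le_bound _ zero_le_one fun x => by simp
      · simp)
  have hBA : ∀ x, B (A x) = x := by
    suffices B ∘L A = ContinuousLinearMap.id 𝕜 _ from fun x => DFunLike.congr_fun this x
    refine lp.ext_continuousLinearMap (by simp) fun i => ?_
    ext
    have h : ∃ i', e i' = e i := ⟨i, rfl⟩
    have : h.choose = i := he h.choose_spec
    simp [hA', hB', this]
  refine ⟨A ∘L V, U ∘L B, ?_, ?_, ?_⟩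
  · exact (A.opNorm_comp_le V).trans
      ((mul_le_of_le_one_left (norm_nonneg _) hA).trans hV)
  · exact (U.opNorm_comp_le B).trans (mul_le_one₀ hU (norm_nonneg _) hB)
  · ext x
    simp [hBA]

lemma mono {M M' : ℝ} {S : H →L[𝕜] Y} (h : FactorsThroughEllOne M S) (hM : M ≤ M') :
    FactorsThroughEllOne M' S := by
  obtain ⟨V, U, hV, hU, rfl⟩ := h
  exact ⟨V, U, hV.trans hM, hU, rfl⟩

lemma norm_le {M : ℝ} {S : H →L[𝕜] Y} (h : FactorsThroughEllOne M S) : ‖S‖ ≤ M := by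
  obtain ⟨V, U, hV, hU, rfl⟩ := h
  exact (U.opNorm_comp_le V).trans ((mul_le_of_le_one_left (norm_nonneg _) hU).trans hV)

lemma smul {M : ℝ} {S : H →L[𝕜] Y} (h : FactorsThroughEllOne M S) (a : 𝕜) :
    FactorsThroughEllOne (‖a‖ * M) (a • S) := by
  obtain ⟨V, U, hV, hU, rfl⟩ := h
  refine ⟨a • V, U, ?_, hU, by ext; simp⟩
  rw [norm_smul]
  gcongr

lemma comp_right {H' : Type*} [NormedAddCommGroup H'] [NormedSpace 𝕜 H'] {M : ℝ}
    {S : H →L[𝕜] Y} (h : FactorsThroughEllOne M S) (A : H' →L[𝕜] H) :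
    FactorsThroughEllOne (M * ‖A‖) (S ∘L A) := by
  obtain ⟨V, U, hV, hU, rfl⟩ := h
  exact ⟨V ∘L A, U, (V.opNorm_comp_le A).trans (by gcongr), hU, rfl⟩

lemma add [CompleteSpace Y] {M₁ M₂ : ℝ} {S₁ S₂ : H →L[𝕜] Y} (h₁ : FactorsThroughEllOne M₁ S₁)
    (h₂ : FactorsThroughEllOne M₂ S₂) : FactorsThroughEllOne (M₁ + M₂) (S₁ + S₂) := by
  obtain ⟨V₁, U₁, hV₁, hU₁, rfl⟩ := h₁
  obtain ⟨V₂, U₂, hV₂, hU₂, rfl⟩ := h₂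
  have key : ∀ c : ℕ → ℕ ⊕ ℕ, ∃ A : lp (fun _ : ℕ => 𝕜) 1 →L[𝕜] lp (fun _ : ℕ ⊕ ℕ => 𝕜) 1,
      ‖A‖ ≤ 1 ∧ ∀ i x, A (lp.single 1 i x) = lp.single 1 (c i) x := fun c => by
    obtain ⟨A, hA, hA', -⟩ := exists_desc (E := fun _ : ℕ => 𝕜) zero_le_one
      (fun i => lp.singleContinuousLinearMap 𝕜 (fun _ : ℕ ⊕ ℕ => 𝕜) 1 (c i))
      (fun i => ContinuousLinearMap.opNorm_le_bound _ zero_le_one fun x => by simp)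
    exact ⟨A, hA, fun i x => by simp [hA']⟩
  obtain ⟨A₁, hA₁, hA₁'⟩ := key Sum.inl
  obtain ⟨A₂, hA₂, hA₂'⟩ := key Sum.inr
  have hs : ∀ {Z : Type _} [NormedAddCommGroup Z] [NormedSpace 𝕜 Z]
      (U : lp (fun _ : ℕ => 𝕜) 1 →L[𝕜] Z) (_ : ‖U‖ ≤ 1) i,
      ‖U ∘L lp.singleContinuousLinearMap 𝕜 (fun _ : ℕ => 𝕜) 1 i‖ ≤ 1 := fun U hU i =>
    ContinuousLinearMap.opNorm_le_bound _ zero_le_one fun x => by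
      simpa using U.le_of_opNorm_le hU (lp.single 1 i x)
  obtain ⟨U, hU, hU', -⟩ := exists_desc (E := fun _ : ℕ ⊕ ℕ => 𝕜) zero_le_one
    (fun s => Sum.elim (fun i => U₁ ∘L lp.singleContinuousLinearMap 𝕜 (fun _ : ℕ => 𝕜) 1 i)
      (fun i => U₂ ∘L lp.singleContinuousLinearMap 𝕜 (fun _ : ℕ => 𝕜) 1 i) s)
    (fun s => by
      cases s
      · exact hs U₁ hU₁ _
      · exact hs U₂ hU₂ _)
  have h₁ : U ∘L A₁ = U₁ := lp.ext_continuousLinearMap (by simp) fun i => by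
    ext; simp [hA₁', hU']
  have h₂ : U ∘L A₂ = U₂ := lp.ext_continuousLinearMap (by simp) fun i => by
    ext; simp [hA₂', hU']
  have : U₁ ∘L V₁ + U₂ ∘L V₂ = U ∘L (A₁ ∘L V₁ + A₂ ∘L V₂) := by
    rw [ContinuousLinearMap.comp_add, ← h₁, ← h₂]
    rfl
  rw [this]
  refine of_index _ _ ((norm_add_le _ _).trans (add_le_add ?_ ?_)) hU
  · exact (A₁.opNorm_comp_le V₁).trans ((mul_le_of_le_one_left (norm_nonneg _) hA₁).trans hV₁)
  · exact (A₂.opNorm_comp_le V₂).trans ((mul_le_of_le_one_left (norm_nonneg _) hA₂).trans hV₂)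

lemma zero : FactorsThroughEllOne 0 (0 : H →L[𝕜] Y) :=
  ⟨0, 0, by simp, by simp, by simp⟩

lemma sum [CompleteSpace Y] {α : Type*} (s : Finset α) (M : α → ℝ) (S : α → H →L[𝕜] Y)
    (h : ∀ a, FactorsThroughEllOne (M a) (S a)) :
    FactorsThroughEllOne (∑ a ∈ s, M a) (∑ a ∈ s, S a) := by
  classical
  induction s using Finset.induction_on with
  | empty => simpa using zero
  | insert a s ha ih =>
    rw [Finset.sum_insert ha, Finset.sum_insert ha]
    exact (h a).add ih

lemma smulRight (f : H →L[𝕜] 𝕜) (y : Y) :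
    FactorsThroughEllOne (‖f‖ * ‖y‖) (f.smulRight y) := by
  let P : lp (fun _ : ℕ => 𝕜) 1 →L[𝕜] 𝕜 := lp.evalCLM 𝕜 (fun _ : ℕ => 𝕜) 1 0
  have hP : ‖P‖ ≤ 1 := ContinuousLinearMap.opNorm_le_bound _ zero_le_one fun x => by
    rw [one_mul]
    exact lp.norm_apply_le_norm (p := 1) (by simp) x 0
  have hP' : ∀ c : 𝕜, P (lp.single 1 0 c) = c := fun c =>
    lp.single_apply_self (E := fun _ : ℕ => 𝕜) 1 0 c
  refine ⟨(‖y‖ : 𝕜) • (lp.singleContinuousLinearMap 𝕜 (fun _ : ℕ => 𝕜) 1 0 ∘L f),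
    P.smulRight ((‖y‖ : 𝕜)⁻¹ • y), ?_, ?_, ?_⟩
  · refine ContinuousLinearMap.opNorm_le_bound _ (by positivity) fun x => ?_
    simp only [smul_apply, ContinuousLinearMap.comp_apply, norm_smul,
      lp.singleContinuousLinearMap_apply, lp.norm_single zero_lt_one]
    rw [RCLike.norm_ofReal, abs_norm, mul_comm ‖f‖, mul_assoc]
    gcongr
    exact f.le_opNorm x
  · rw [ContinuousLinearMap.norm_smulRight_apply, norm_smul, norm_inv, RCLike.norm_ofReal,
      abs_norm]
    exact mul_le_one₀ hP (by positivity) (inv_mul_le_one)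
  · ext x
    rcases eq_or_ne y 0 with rfl | hy
    · simp
    · have : (‖y‖ : 𝕜) ≠ 0 := by simpa using hy
      simp only [ContinuousLinearMap.smulRight_apply, ContinuousLinearMap.comp_apply, smul_apply,
        map_smul, lp.singleContinuousLinearMap_apply, hP', smul_smul]
      rw [mul_left_comm, mul_inv_cancel₀ this, mul_one]

lemma of_single {ι : Type*} [DecidableEq ι] {E : ι → Type*} [∀ i, NormedAddCommGroup (E i)]
    [∀ i, NormedSpace 𝕜 (E i)] [Countable ι] [CompleteSpace Y] {M : ℝ} (hM : 0 ≤ M)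
    (S : lp E 1 →L[𝕜] Y) (h : ∀ i, FactorsThroughEllOne M (S ∘L lp.singleContinuousLinearMap 𝕜 E 1 i)) :
    FactorsThroughEllOne M S := by
  choose V U hV hU hS using h
  have key : ∀ i, ∃ A : lp (fun _ : ℕ => 𝕜) 1 →L[𝕜] lp (fun _ : ι × ℕ => 𝕜) 1,
      ‖A‖ ≤ 1 ∧ ∀ j x, A (lp.single 1 j x) = lp.single 1 (i, j) x := fun i => by
    obtain ⟨A, hA, hA', -⟩ := exists_desc (E := fun _ : ℕ => 𝕜) zero_le_one
      (fun j => lp.singleContinuousLinearMap 𝕜 (fun _ : ι × ℕ => 𝕜) 1 (i, j))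
      (fun j => ContinuousLinearMap.opNorm_le_bound _ zero_le_one fun x => by simp)
    exact ⟨A, hA, fun j x => by simp [hA']⟩
  choose A hA hA' using key
  obtain ⟨W, hW, hW', -⟩ := exists_desc hM (fun i => A i ∘L V i) fun i =>
    ((A i).opNorm_comp_le (V i)).trans ((mul_le_of_le_one_left (norm_nonneg _) (hA i)).trans (hV i))
  obtain ⟨Z, hZ, hZ', -⟩ := exists_desc (E := fun _ : ι × ℕ => 𝕜) zero_le_one
    (fun p => U p.1 ∘L lp.singleContinuousLinearMap 𝕜 (fun _ : ℕ => 𝕜) 1 p.2)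
    (fun p => ContinuousLinearMap.opNorm_le_bound _ zero_le_one fun x => by
      simpa using (U p.1).le_of_opNorm_le (hU p.1) (lp.single 1 p.2 x))
  have hZA : ∀ i, Z ∘L A i = U i := fun i => lp.ext_continuousLinearMap (by simp) fun j => by
    ext; simp [hZ', hA']
  have : S = Z ∘L W := lp.ext_continuousLinearMap (by simp) fun i => by
    rw [hS, ← hZA]
    ext x
    simp [hW']
  rw [this]
  exact of_index _ _ hW hZ

/-- The orthogonal projection onto a subspace of dimension at most `r`, followed by an operator. -/
lemma comp_starProjection [CompleteSpace Y] {F : Type*} [NormedAddCommGroup F]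
    [InnerProductSpace 𝕜 F] (K : Submodule 𝕜 F) [FiniteDimensional 𝕜 K] {r : ℕ}
    (hr : Module.finrank 𝕜 K ≤ r) (A : F →L[𝕜] Y) :
    FactorsThroughEllOne (r * ‖A‖) (A ∘L K.starProjection) := by
  let b := stdOrthonormalBasis 𝕜 K
  have : A ∘L K.starProjection = ∑ i, (innerSL 𝕜 (b i : F)).smulRight (A (b i)) := by
    ext x
    simp only [ContinuousLinearMap.comp_apply, K.starProjection_apply,
      b.orthogonalProjectionOnto_apply_eq_sum, Submodule.coe_sum, Submodule.coe_smul, map_sum,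
      map_smul, sum_apply, ContinuousLinearMap.smulRight_apply,
      innerSL_apply_apply]
  rw [this]
  refine (sum Finset.univ (fun _ => ‖A‖) _ fun i => ?_).mono ?_
  · refine (smulRight _ _).mono ?_
    have hb : ‖(b i : F)‖ = 1 := b.orthonormal.1 i
    rw [innerSL_apply_norm, hb, one_mul]
    simpa [hb] using A.le_opNorm (b i)
  · simp only [Finset.sum_const, Finset.card_univ, Fintype.card_fin, nsmul_eq_mul]
    gcongr

end FactorsThroughEllOne

end EllOne

section RandomSigns

open Finset
open scoped BigOperators

variable {𝕜 : Type*} [RCLike 𝕜] {F : Type*} [NormedAddCommGroup F] [InnerProductSpace 𝕜 F]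

/-- The scalar `1` or `-1` encoded by a Boolean. -/
def boolSign (𝕜 : Type*) [RCLike 𝕜] (b : Bool) : 𝕜 := if b then 1 else -1

lemma boolSign_not (b : Bool) : boolSign 𝕜 (!b) = -boolSign 𝕜 b := by
  cases b <;> simp [boolSign]

lemma boolSign_mul_self (b : Bool) : boolSign 𝕜 b * boolSign 𝕜 b = 1 := by
  cases b <;> simp [boolSign]

lemma conj_boolSign (b : Bool) : (starRingEnd 𝕜) (boolSign 𝕜 b) = boolSign 𝕜 b := by
  cases b <;> simp [boolSign]

lemma norm_boolSign (b : Bool) : ‖boolSign 𝕜 b‖ = 1 := by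
  cases b <;> simp [boolSign]

variable {I : Type*} [Fintype I] [DecidableEq I]

lemma expect_norm_add_boolSign_smul (t : I) (D L : (I → Bool) → F)
    (hD : ∀ ω, D (Function.update ω t (!ω t)) = D ω)
    (hL : ∀ ω, L (Function.update ω t (!ω t)) = L ω) :
    𝔼 ω : I → Bool, ‖D ω + boolSign 𝕜 (ω t) • L ω‖ ^ 2 =
      𝔼 ω, ‖D ω‖ ^ 2 + 𝔼 ω, ‖L ω‖ ^ 2 := by
  have hinv : Function.Involutive fun ω : I → Bool => Function.update ω t (!ω t) := fun ω => by
    simp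
  have h1 : 𝔼 ω : I → Bool, ‖D ω + boolSign 𝕜 (ω t) • L ω‖ ^ 2 =
      𝔼 ω : I → Bool, ‖D ω - boolSign 𝕜 (ω t) • L ω‖ ^ 2 :=
    Fintype.expect_equiv hinv.toPerm _ _ fun ω => by
      simp [hD, hL, boolSign_not]
  have h2 : 𝔼 ω : I → Bool, ‖D ω + boolSign 𝕜 (ω t) • L ω‖ ^ 2 +
      𝔼 ω : I → Bool, ‖D ω - boolSign 𝕜 (ω t) • L ω‖ ^ 2 =
      2 * (𝔼 ω, ‖D ω‖ ^ 2 + 𝔼 ω, ‖L ω‖ ^ 2) := by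
    rw [← expect_add_distrib, ← expect_add_distrib, mul_expect]
    refine expect_congr rfl fun ω _ => ?_
    have := parallelogram_law_with_norm 𝕜 (D ω) (boolSign 𝕜 (ω t) • L ω)
    rw [norm_smul, norm_boolSign, one_mul] at this
    linarith
  linarith

lemma expect_norm_sum_boolSign_smul (s : Finset I) (z : I → F) :
    𝔼 ω : I → Bool, ‖∑ i ∈ s, boolSign 𝕜 (ω i) • z i‖ ^ 2 = ∑ i ∈ s, ‖z i‖ ^ 2 := by
  induction s using Finset.induction_on with
  | empty => simp
  | insert t s ht ih =>
    have := expect_norm_add_boolSign_smul (𝕜 := 𝕜) t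
      (fun ω => ∑ i ∈ s, boolSign 𝕜 (ω i) • z i) (fun _ => z t) (fun ω =>
        sum_congr rfl fun i hi => by
          rw [Function.update_of_ne (ne_of_mem_of_not_mem hi ht)]) (fun _ => rfl)
    simp only [sum_insert ht, ih, Fintype.expect_const] at this ⊢
    rw [add_comm, ← this]
    simp only [add_comm]

lemma expect_norm_offDiag_le (s : Finset I) (c : I → I → 𝕜) :
    𝔼 ω : I → Bool, ‖∑ i ∈ s, ∑ j ∈ s,
      if i = j then 0 else boolSign 𝕜 (ω i) * boolSign 𝕜 (ω j) * c i j‖ ^ 2 ≤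
      2 * ∑ i ∈ s, ∑ j ∈ s, ‖c i j‖ ^ 2 := by
  induction s using Finset.induction_on with
  | empty => simp
  | insert t s ht ih =>
    have h := expect_norm_add_boolSign_smul (𝕜 := 𝕜) t
      (fun ω => ∑ i ∈ s, ∑ j ∈ s,
        if i = j then 0 else boolSign 𝕜 (ω i) * boolSign 𝕜 (ω j) * c i j)
      (fun ω => ∑ i ∈ s, boolSign 𝕜 (ω i) • (c i t + c t i))
      (fun ω => sum_congr rfl fun i hi => sum_congr rfl fun j hj => by
        rw [Function.update_of_ne (ne_of_mem_of_not_mem hi ht),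
          Function.update_of_ne (ne_of_mem_of_not_mem hj ht)])
      (fun ω => sum_congr rfl fun i hi => by
        rw [Function.update_of_ne (ne_of_mem_of_not_mem hi ht)])
    rw [expect_norm_sum_boolSign_smul] at h
    have e : ∀ ω : I → Bool, (∑ i ∈ insert t s, ∑ j ∈ insert t s,
        if i = j then 0 else boolSign 𝕜 (ω i) * boolSign 𝕜 (ω j) * c i j) =
        (∑ i ∈ s, ∑ j ∈ s,
          if i = j then 0 else boolSign 𝕜 (ω i) * boolSign 𝕜 (ω j) * c i j) +
        boolSign 𝕜 (ω t) • ∑ i ∈ s, boolSign 𝕜 (ω i) • (c i t + c t i) := fun ω => by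
      have h1 : ∀ i ∈ s, i ≠ t := fun i hi => ne_of_mem_of_not_mem hi ht
      simp only [sum_insert ht, if_true, zero_add, sum_add_distrib, smul_eq_mul]
      rw [sum_congr rfl fun i hi => if_neg (h1 i hi).symm,
        sum_congr rfl fun i hi => if_neg (h1 i hi)]
      rw [← add_assoc, add_comm, ← sum_add_distrib, mul_sum]
      congr 1
      refine sum_congr rfl fun i _ => by ring
    simp only [e]
    rw [h]
    have h2 : ∑ i ∈ s, ‖c i t + c t i‖ ^ 2 ≤
        2 * (∑ i ∈ s, ‖c i t‖ ^ 2 + ∑ i ∈ s, ‖c t i‖ ^ 2) := by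
      rw [← sum_add_distrib, mul_sum]
      refine sum_le_sum fun i _ => ?_
      have := norm_add_le (c i t) (c t i)
      have := norm_nonneg (c i t + c t i)
      nlinarith [sq_nonneg (‖c i t‖ - ‖c t i‖)]
    simp only [sum_insert ht, sum_add_distrib]
    nlinarith [sq_nonneg ‖c t t‖]

variable {A : Type*} [Fintype A] [DecidableEq A] {k : ℕ}

/-- The `j`-th random signed sum of a finite family of vectors. -/
def signedSum (𝕜 : Type*) [RCLike 𝕜] [Module 𝕜 F] (u : A → F) (ω : A × Fin k → Bool)
    (j : Fin k) : F :=
  ∑ a, boolSign 𝕜 (ω (a, j)) • u a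

lemma expect_norm_signedSum_sq (u : A → F) (j : Fin k) :
    𝔼 ω, ‖signedSum 𝕜 u ω j‖ ^ 2 = ∑ a, ‖u a‖ ^ 2 := by
  have h := expect_norm_sum_boolSign_smul (𝕜 := 𝕜) (univ : Finset (A × Fin k))
    (fun p => if p.2 = j then u p.1 else 0)
  simp only [Fintype.sum_prod_type] at h
  simpa [signedSum, smul_ite, apply_ite, ite_pow] using h

lemma expect_norm_inner_signedSum_sub_le (u : A → F) (j l : Fin k) :
    𝔼 ω, ‖inner 𝕜 (signedSum 𝕜 u ω j) (signedSum 𝕜 u ω l) -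
      (if j = l then ((∑ a, ‖u a‖ ^ 2 : ℝ) : 𝕜) else 0)‖ ^ 2 ≤
      2 * ∑ a, ∑ b, ‖inner 𝕜 (u a) (u b)‖ ^ 2 := by
  let c : A × Fin k → A × Fin k → 𝕜 := fun p q =>
    if p.2 = j then if q.2 = l then inner 𝕜 (u p.1) (u q.1) else 0 else 0
  have h := expect_norm_offDiag_le (univ : Finset (A × Fin k)) c
  have h2 : ∑ p, ∑ q, ‖c p q‖ ^ 2 = ∑ a, ∑ b, ‖inner 𝕜 (u a) (u b)‖ ^ 2 := by
    simp only [Fintype.sum_prod_type, c]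
    simp [apply_ite, ite_pow]
  have h3 : ∀ ω : A × Fin k → Bool, (∑ p, ∑ q,
      if p = q then 0 else boolSign 𝕜 (ω p) * boolSign 𝕜 (ω q) * c p q) =
      inner 𝕜 (signedSum 𝕜 u ω j) (signedSum 𝕜 u ω l) -
      (if j = l then ((∑ a, ‖u a‖ ^ 2 : ℝ) : 𝕜) else 0) := fun ω => by
    have h4 : ∀ p q, (if p = q then 0 else boolSign 𝕜 (ω p) * boolSign 𝕜 (ω q) * c p q) =
        boolSign 𝕜 (ω p) * boolSign 𝕜 (ω q) * c p q - if p = q then c p p else 0 := fun p q => by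
      split_ifs with hpq
      · rw [hpq, boolSign_mul_self, one_mul, sub_self]
      · rw [sub_zero]
    simp only [h4, sum_sub_distrib]
    congr 1
    · simp only [signedSum, sum_inner, inner_sum, inner_smul_left, inner_smul_right,
        conj_boolSign, Fintype.sum_prod_type, c]
      simp only [mul_ite, mul_zero, sum_ite_irrel, sum_const_zero, sum_ite_eq', mem_univ, if_true,
        mul_assoc, mul_sum]
      rw [sum_comm]
      exact sum_congr rfl fun a _ => sum_congr rfl fun b _ => by ring
    · simp only [sum_ite_eq, mem_univ, if_true, Fintype.sum_prod_type, c, sum_ite_eq']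
      split_ifs <;> simp [inner_self_eq_norm_sq_to_K]
  simpa only [h3, h2] using h

lemma expect_norm_inner_signedSum_sub_le' (u : A → F) (j l : Fin k) {τ : ℝ} (hτ : 0 ≤ τ)
    (h : ∑ a, ∑ b, ‖inner 𝕜 (u a) (u b)‖ ^ 2 ≤ τ ^ 2) :
    𝔼 ω, ‖inner 𝕜 (signedSum 𝕜 u ω j) (signedSum 𝕜 u ω l) -
      (if j = l then ((∑ a, ‖u a‖ ^ 2 : ℝ) : 𝕜) else 0)‖ ≤ 2 * τ := by
  have h1 := (expect_norm_inner_signedSum_sub_le (𝕜 := 𝕜) u j l).trans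
    (mul_le_mul_of_nonneg_left h zero_le_two)
  refine abs_le_of_sq_le_sq' ?_ (by positivity) |>.2
  set f : (A × Fin k → Bool) → ℝ := fun ω => ‖inner 𝕜 (signedSum 𝕜 u ω j) (signedSum 𝕜 u ω l) -
      (if j = l then ((∑ a, ‖u a‖ ^ 2 : ℝ) : 𝕜) else 0)‖
  have h2 : (𝔼 ω, f ω) ^ 2 ≤ 𝔼 ω, f ω ^ 2 := by
    have h3 : 0 ≤ 𝔼 ω, (f ω - 𝔼 ω, f ω) ^ 2 := expect_nonneg fun _ _ => sq_nonneg _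
    simp only [sub_sq, expect_add_distrib, expect_sub_distrib, Fintype.expect_const,
      ← expect_mul, ← mul_expect] at h3
    linarith
  have h4 : 𝔼 ω, f ω ^ 2 ≤ 2 * τ ^ 2 := h1
  nlinarith

/-- A Khintchine inequality for signed sums of vectors. -/
lemma sqrt_sum_sq_le_expect_norm_signedSum (u : A → F) (j : Fin k) :
    √(∑ a, ‖u a‖ ^ 2) ≤ 2 * 𝔼 ω, ‖signedSum 𝕜 u ω j‖ := by
  set s := √(∑ a, ‖u a‖ ^ 2) with hs
  have hs2 : s ^ 2 = ∑ a, ‖u a‖ ^ 2 := Real.sq_sqrt (by positivity)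
  rcases (Real.sqrt_nonneg (∑ a, ‖u a‖ ^ 2)).eq_or_lt with h0 | h0
  · rw [hs, ← h0]
    exact mul_nonneg zero_le_two (expect_nonneg fun _ _ => norm_nonneg _)
  have h1 := expect_norm_signedSum_sq (𝕜 := 𝕜) u j
  have h2 := expect_norm_inner_signedSum_sub_le (𝕜 := 𝕜) u j j
  have h3 : ∑ a, ∑ b, ‖inner 𝕜 (u a) (u b)‖ ^ 2 ≤ s ^ 4 := by
    calc _ ≤ ∑ a, ∑ b, ‖u a‖ ^ 2 * ‖u b‖ ^ 2 := by
          refine sum_le_sum fun a _ => sum_le_sum fun b _ => ?_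
          rw [← mul_pow]
          gcongr
          exact norm_inner_le_norm _ _
      _ = s ^ 4 := by rw [← sum_mul_sum, ← hs2]; ring
  have h4 : ∀ ω, ‖inner 𝕜 (signedSum 𝕜 u ω j) (signedSum 𝕜 u ω j) -
      (if j = j then ((∑ a, ‖u a‖ ^ 2 : ℝ) : 𝕜) else 0)‖ ^ 2 =
      (‖signedSum 𝕜 u ω j‖ ^ 2 - s ^ 2) ^ 2 := fun ω => by
    rw [if_pos rfl, inner_self_eq_norm_sq_to_K, ← hs2, ← RCLike.ofReal_pow,
      ← RCLike.ofReal_sub, RCLike.norm_ofReal, sq_abs]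
  rw [expect_congr rfl fun ω _ => h4 ω] at h2
  have h5 : 𝔼 ω : A × Fin k → Bool, (16 * s ^ 3 * ‖signedSum 𝕜 u ω j‖) ≥
      𝔼 ω : A × Fin k → Bool, (10 * s ^ 2 * ‖signedSum 𝕜 u ω j‖ ^ 2 + s ^ 4 -
        (‖signedSum 𝕜 u ω j‖ ^ 2 - s ^ 2) ^ 2) := by
    refine expect_le_expect fun ω _ => ?_
    set x := ‖signedSum 𝕜 u ω j‖
    have hx : 0 ≤ x := norm_nonneg _
    have : 0 ≤ x * (x - 2 * s) ^ 2 * (x + 4 * s) := by positivity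
    nlinarith
  rw [← mul_expect, expect_sub_distrib, expect_add_distrib, ← mul_expect, h1,
    Fintype.expect_const, ← hs2] at h5
  have h6 : 8 * s ^ 4 ≤ 16 * s ^ 3 * 𝔼 ω : A × Fin k → Bool, ‖signedSum 𝕜 u ω j‖ := by
    nlinarith
  have h7 : 0 < s ^ 3 := by positivity
  nlinarith

end RandomSigns

section Synthesis

open Finset

variable {𝕜 : Type*} [RCLike 𝕜] {F : Type*} [NormedAddCommGroup F] [InnerProductSpace 𝕜 F] {k : ℕ}

/-- The operator sending the standard basis of `𝕜ᵏ` to `v`. -/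
noncomputable def synthesis (𝕜 : Type*) [RCLike 𝕜] [InnerProductSpace 𝕜 F] (v : Fin k → F) :
    EuclideanSpace 𝕜 (Fin k) →L[𝕜] F :=
  ∑ j, (EuclideanSpace.proj j : EuclideanSpace 𝕜 (Fin k) →L[𝕜] 𝕜).smulRight (v j)

lemma synthesis_apply (v : Fin k → F) (x : EuclideanSpace 𝕜 (Fin k)) :
    synthesis 𝕜 v x = ∑ j, x j • v j := by
  simp [synthesis]

/-- The entrywise deviation of the Gram matrix of `v` from `ρ²` times the identity. -/
noncomputable def gramDefect (𝕜 : Type*) [RCLike 𝕜] [InnerProductSpace 𝕜 F] (v : Fin k → F)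
    (ρ : ℝ) : ℝ :=
  ∑ j, ∑ l, ‖inner 𝕜 (v j) (v l) - (if j = l then ((ρ ^ 2 : ℝ) : 𝕜) else 0)‖

lemma gramDefect_nonneg (v : Fin k → F) (ρ : ℝ) : 0 ≤ gramDefect 𝕜 v ρ :=
  sum_nonneg fun _ _ => sum_nonneg fun _ _ => norm_nonneg _

lemma norm_inner_synthesis_sub_le (v : Fin k → F) (ρ : ℝ) (x y : EuclideanSpace 𝕜 (Fin k)) :
    ‖inner 𝕜 (synthesis 𝕜 v x) (synthesis 𝕜 v y) - ((ρ ^ 2 : ℝ) : 𝕜) * inner 𝕜 x y‖ ≤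
      gramDefect 𝕜 v ρ * (‖x‖ * ‖y‖) := by
  have h : inner 𝕜 (synthesis 𝕜 v x) (synthesis 𝕜 v y) - ((ρ ^ 2 : ℝ) : 𝕜) * inner 𝕜 x y =
      ∑ j, ∑ l, (starRingEnd 𝕜) (x j) * y l *
        (inner 𝕜 (v j) (v l) - (if j = l then ((ρ ^ 2 : ℝ) : 𝕜) else 0)) := by
    simp only [synthesis_apply, sum_inner, inner_sum, inner_smul_left, inner_smul_right, mul_sub,
      sum_sub_distrib, mul_ite, mul_zero, sum_ite_eq, mem_univ, if_true, PiLp.inner_apply,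
      RCLike.inner_apply, mul_sum]
    congr 1
    · rw [sum_comm]
      exact sum_congr rfl fun j _ => sum_congr rfl fun l _ => by ring
    · exact sum_congr rfl fun j _ => by ring
  rw [h, gramDefect, sum_mul]
  refine (norm_sum_le _ _).trans (sum_le_sum fun j _ => ?_)
  rw [sum_mul]
  refine (norm_sum_le _ _).trans (sum_le_sum fun l _ => ?_)
  rw [norm_mul, norm_mul, RCLike.norm_conj, mul_comm]
  gcongr
  · exact PiLp.norm_apply_le x j
  · exact PiLp.norm_apply_le y l

lemma norm_synthesis_le (v : Fin k → F) (ρ : ℝ) :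
    ‖synthesis 𝕜 v‖ ≤ √(ρ ^ 2 + gramDefect 𝕜 v ρ) := by
  refine ContinuousLinearMap.opNorm_le_bound _ (Real.sqrt_nonneg _) fun x => ?_
  refine abs_le_of_sq_le_sq' ?_ (by positivity) |>.2
  rw [mul_pow, Real.sq_sqrt (by have := gramDefect_nonneg (𝕜 := 𝕜) v ρ; positivity)]
  have h := norm_inner_synthesis_sub_le (𝕜 := 𝕜) v ρ x x
  rw [inner_self_eq_norm_sq_to_K, inner_self_eq_norm_sq_to_K, ← RCLike.ofReal_pow,
    ← RCLike.ofReal_pow, ← RCLike.ofReal_mul, ← RCLike.ofReal_sub, RCLike.norm_ofReal] at h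
  nlinarith [le_abs_self (‖synthesis 𝕜 v x‖ ^ 2 - ρ ^ 2 * ‖x‖ ^ 2)]

/-- A contractive approximate left inverse, up to the factor `ρ`, of `synthesis 𝕜 v`. -/
lemma exists_contraction_comp_synthesis [CompleteSpace F] (v : Fin k → F) {ρ : ℝ} (hρ : 0 ≤ ρ) :
    ∃ W : F →L[𝕜] EuclideanSpace 𝕜 (Fin k), ‖W‖ ≤ 1 ∧
      ∀ x, ‖W (synthesis 𝕜 v x) - (ρ : 𝕜) • x‖ ≤
        2 * ρ * gramDefect 𝕜 v ρ / (ρ ^ 2 + gramDefect 𝕜 v ρ) * ‖x‖ := by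
  set Y := gramDefect 𝕜 v ρ
  have hY : 0 ≤ Y := gramDefect_nonneg v ρ
  rcases (add_nonneg (sq_nonneg ρ) hY).eq_or_lt with h0 | h0
  · have : ρ = 0 := by nlinarith
    exact ⟨0, by simp, by simp [this]⟩
  set L := synthesis 𝕜 v
  have hL : ‖L‖ ≤ √(ρ ^ 2 + Y) := norm_synthesis_le v ρ
  have hs : 0 < √(ρ ^ 2 + Y) := Real.sqrt_pos.2 h0
  have hs2 : √(ρ ^ 2 + Y) ^ 2 = ρ ^ 2 + Y := Real.sq_sqrt h0.le
  refine ⟨((ρ / (ρ ^ 2 + Y) : ℝ) : 𝕜) • L.adjoint, ?_, fun x => ?_⟩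
  · rw [norm_smul, LinearIsometryEquiv.norm_map, RCLike.norm_ofReal, abs_of_nonneg (by positivity)]
    have h1 : ρ ≤ √(ρ ^ 2 + Y) := Real.le_sqrt_of_sq_le (by linarith)
    rw [div_mul_eq_mul_div, div_le_one h0, ← hs2, sq]
    gcongr
  · set z := L.adjoint (L x) - ((ρ ^ 2 : ℝ) : 𝕜) • x with hz
    have hG : ‖z‖ ≤ Y * ‖x‖ := by
      have h1 := norm_inner_synthesis_sub_le (𝕜 := 𝕜) v ρ z x
      have h2 : inner 𝕜 (L z) (L x) - ((ρ ^ 2 : ℝ) : 𝕜) * inner 𝕜 z x = inner 𝕜 z z := by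
        rw [← ContinuousLinearMap.adjoint_inner_right, ← inner_smul_right, ← inner_sub_right, ← hz]
      rw [h2, inner_self_eq_norm_sq_to_K, ← RCLike.ofReal_pow, RCLike.norm_ofReal, abs_sq] at h1
      rcases (norm_nonneg z).eq_or_lt with h3 | h3
      · rw [← h3]; positivity
      · have : ‖z‖ * ‖z‖ ≤ ‖z‖ * (Y * ‖x‖) := by nlinarith
        exact le_of_mul_le_mul_left this h3
    have e : (((ρ / (ρ ^ 2 + Y) : ℝ) : 𝕜) • L.adjoint) (L x) - (ρ : 𝕜) • x =
        ((ρ / (ρ ^ 2 + Y) : ℝ) : 𝕜) • z - ((ρ / (ρ ^ 2 + Y) * Y : ℝ) : 𝕜) • x := by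
      have : (ρ : 𝕜) = ((ρ / (ρ ^ 2 + Y) : ℝ) : 𝕜) * ((ρ ^ 2 : ℝ) : 𝕜) +
          ((ρ / (ρ ^ 2 + Y) * Y : ℝ) : 𝕜) := by
        rw [← RCLike.ofReal_mul, ← RCLike.ofReal_add]
        congr 1
        field_simp
      rw [hz, smul_sub, smul_smul, this, add_smul, smul_apply]
      abel
    rw [e]
    have h0' : 0 ≤ ρ / (ρ ^ 2 + Y) := by positivity
    calc _ ≤ ρ / (ρ ^ 2 + Y) * (Y * ‖x‖) + ρ / (ρ ^ 2 + Y) * Y * ‖x‖ := by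
          refine (norm_sub_le _ _).trans (add_le_add ?_ ?_)
          · rw [norm_smul, RCLike.norm_ofReal, abs_of_nonneg h0']
            gcongr
          · rw [norm_smul, RCLike.norm_ofReal, abs_of_nonneg (by positivity)]
      _ = _ := by ring

end Synthesis

section Selection

open Finset

/-- Greedy selection: either there is an orthonormal `r`-tuple in `p`, or some subspace of dimension
at most `r` has no unit vector of its orthogonal complement in `p`. -/
lemma exists_orthonormal_or_exists_submodule {𝕜 : Type*} [RCLike 𝕜] {F : Type*}
    [NormedAddCommGroup F] [InnerProductSpace 𝕜 F] (p : F → Prop) (r : ℕ) :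
    (∃ v : Fin r → F, Orthonormal 𝕜 v ∧ ∀ i, p (v i)) ∨
      ∃ K : Submodule 𝕜 F, FiniteDimensional 𝕜 K ∧ Module.finrank 𝕜 K ≤ r ∧
        ∀ y ∈ Kᗮ, ‖y‖ = 1 → ¬ p y := by
  induction r with
  | zero => exact Or.inl ⟨Fin.elim0, ⟨fun i => i.elim0, fun i => i.elim0⟩, fun i => i.elim0⟩
  | succ r ih =>
    rcases ih with ⟨v, hv, hp⟩ | ⟨K, hK, hr, h⟩
    swap
    · exact Or.inr ⟨K, hK, hr.trans r.le_succ, h⟩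
    by_cases hy : ∃ y ∈ (Submodule.span 𝕜 (Set.range v))ᗮ, ‖y‖ = 1 ∧ p y
    · obtain ⟨y, hy, hy1, hpy⟩ := hy
      have hin : ∀ i, inner 𝕜 (v i) y = 0 := fun i =>
        (Submodule.mem_orthogonal _ _).1 hy _ (Submodule.subset_span ⟨i, rfl⟩)
      refine Or.inl ⟨Fin.cons y v, ⟨?_, ?_⟩, ?_⟩
      · exact Fin.cases (by simpa using hy1) fun i => by simpa using hv.1 i
      · intro i j
        refine Fin.cases ?_ (fun i => ?_) i <;> refine Fin.cases ?_ (fun j => ?_) j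
        · simp
        · simpa using fun _ => inner_eq_zero_symm.1 (hin j)
        · simpa using hin i
        · simpa using fun h => hv.2 h
      · exact Fin.cases (by simpa using hpy) fun i => by simpa using hp i
    · push Not at hy
      refine Or.inr ⟨_, FiniteDimensional.span_of_finite 𝕜 (Set.finite_range v), ?_, hy⟩
      exact (finrank_range_le_card (R := 𝕜) v).trans (by simp)

/-- A finite minimax principle. -/
lemma exists_weights {ι S : Type*} [Fintype ι] {K : Set S} (hne : K.Nonempty) (h : ι → S → ℝ)
    (hh : ∀ s ∈ K, ∀ t ∈ K, ∀ a b : ℝ, 0 ≤ a → 0 ≤ b → a + b = 1 →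
      ∃ u ∈ K, ∀ i, h i u ≤ a * h i s + b * h i t)
    {c : ℝ} (hc : ∀ s ∈ K, ∃ i, c ≤ h i s) :
    ∃ p : ι → ℝ, (∀ i, 0 ≤ p i) ∧ ∑ i, p i = 1 ∧ ∀ s ∈ K, c ≤ ∑ i, p i * h i s := by
  classical
  obtain ⟨s₀, hs₀⟩ := hne
  have hO : Convex ℝ (Set.univ.pi fun _ : ι => Set.Iio c) := convex_pi fun i _ => convex_Iio c
  have hO' : IsOpen (Set.univ.pi fun _ : ι => Set.Iio c) :=
    isOpen_set_pi Set.finite_univ fun i _ => isOpen_Iio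
  have hA : Convex ℝ {y : ι → ℝ | ∃ s ∈ K, ∀ i, h i s ≤ y i} := by
    rintro x ⟨s, hs, hsx⟩ y ⟨t, ht, hty⟩ a b ha hb hab
    obtain ⟨u, hu, hu'⟩ := hh s hs t ht a b ha hb hab
    refine ⟨u, hu, fun i => (hu' i).trans ?_⟩
    simp only [Pi.add_apply, Pi.smul_apply, smul_eq_mul]
    gcongr
    exacts [hsx i, hty i]
  have hd : Disjoint (Set.univ.pi fun _ : ι => Set.Iio c)
      {y : ι → ℝ | ∃ s ∈ K, ∀ i, h i s ≤ y i} := by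
    rw [Set.disjoint_left]
    rintro y hy ⟨s, hs, hsy⟩
    obtain ⟨i, hi⟩ := hc s hs
    exact absurd (hi.trans (hsy i)) (not_le.2 (hy i trivial))
  obtain ⟨f, u, hf1, hf2⟩ := geometric_hahn_banach_open hO hO' hA hd
  set q : ι → ℝ := fun i => f (Pi.single i 1) with hq
  have hf : ∀ y : ι → ℝ, f y = ∑ i, q i * y i := fun y => by
    conv_lhs => rw [← univ_sum_single y, map_sum]
    refine sum_congr rfl fun i _ => ?_
    rw [hq, show (Pi.single i (y i) : ι → ℝ) = y i • Pi.single i 1 by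
      rw [← Pi.single_smul, smul_eq_mul, mul_one], map_smul, smul_eq_mul, mul_comm]
  have hu : u ≤ f fun i => h i s₀ := hf2 _ ⟨s₀, hs₀, fun i => le_rfl⟩
  have hq0 : ∀ i, 0 ≤ q i := by
    intro i
    by_contra! hi
    have key : ∀ t : ℝ, 0 ≤ t → u ≤ f (fun i => h i s₀) + t * q i := fun t ht => by
      have := hf2 ((fun i => h i s₀) + t • Pi.single i 1) ⟨s₀, hs₀, fun j => by
        simp only [Pi.add_apply, Pi.smul_apply, smul_eq_mul, le_add_iff_nonneg_right]
        rcases eq_or_ne j i with rfl | hj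
        · simpa using ht
        · simp [hj]⟩
      rwa [map_add, map_smul, smul_eq_mul] at this
    have h1 := key ((f (fun i => h i s₀) - u + 1) / -q i) (div_nonneg (by linarith) (by linarith))
    have h2 : (f (fun i => h i s₀) - u + 1) / -q i * q i = -(f (fun i => h i s₀) - u + 1) := by
      rw [div_neg, neg_mul, div_mul_cancel₀ _ hi.ne]
    linarith
  have hconst : ∀ ε > 0, (c - ε) * ∑ i, q i < u := fun ε hε => by
    have := hf1 (fun _ => c - ε) fun i _ => by simpa using hε
    rwa [hf, ← sum_mul, mul_comm] at this
  have hQ : 0 < ∑ i, q i := by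
    refine (sum_nonneg fun i _ => hq0 i).lt_of_ne' fun h0 => ?_
    have h1 := (sum_eq_zero_iff_of_nonneg fun i _ => hq0 i).1 h0
    have h2 := hconst 1 one_pos
    rw [h0, mul_zero] at h2
    rw [hf, sum_eq_zero fun i hi => by rw [h1 i hi, zero_mul]] at hu
    linarith
  refine ⟨fun i => q i / ∑ i, q i, fun i => div_nonneg (hq0 i) hQ.le, ?_, fun s hs => ?_⟩
  · rw [← sum_div, div_self hQ.ne']
  · have h1 : u ≤ ∑ i, q i * h i s := by
      rw [← hf]
      exact hf2 _ ⟨s, hs, fun i => le_rfl⟩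
    have h2 : c * ∑ i, q i ≤ u := by
      refine le_of_forall_pos_le_add fun ε hε => ?_
      have := hconst (ε / ∑ i, q i) (by positivity)
      rw [sub_mul, div_mul_cancel₀ _ hQ.ne'] at this
      linarith
    simp only [div_mul_eq_mul_div]
    rw [← sum_div, le_div_iff₀ hQ]
    exact h2.trans h1

end Selection

section RandomEmbedding

open Finset
open scoped BigOperators

variable {𝕜 : Type*} [RCLike 𝕜] {F : Type*} [NormedAddCommGroup F] [InnerProductSpace 𝕜 F] {k : ℕ}
  {A : Type*} [Fintype A]

lemma map_signedSum {F' : Type*} [NormedAddCommGroup F'] [InnerProductSpace 𝕜 F'] (L : F →ₗ[𝕜] F')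
    (u : A → F) (ω : A × Fin k → Bool) (j : Fin k) :
    L (signedSum 𝕜 u ω j) = signedSum 𝕜 (fun a => L (u a)) ω j := by
  simp [signedSum]

lemma map_synthesis {F' : Type*} [NormedAddCommGroup F'] [InnerProductSpace 𝕜 F'] (L : F →ₗ[𝕜] F')
    (v : Fin k → F) (x : EuclideanSpace 𝕜 (Fin k)) :
    L (synthesis 𝕜 v x) = synthesis 𝕜 (fun j => L (v j)) x := by
  simp [synthesis_apply]

lemma sum_norm_inner_sq_le {u : A → F} {c r : ℝ} (hr : ∑ a, ‖u a‖ ^ 2 = r)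
    (h : ∀ b, ∑ a, ‖inner 𝕜 (u a) (u b)‖ ^ 2 ≤ c * ‖u b‖ ^ 2) :
    ∑ a, ∑ b, ‖inner 𝕜 (u a) (u b)‖ ^ 2 ≤ c * r := by
  rw [sum_comm, ← hr, mul_sum]
  exact sum_le_sum fun b _ => h b

variable [DecidableEq A]

lemma expect_gramDefect_signedSum_le (u : A → F) {ρ τ : ℝ} (hρ : ρ ^ 2 = ∑ a, ‖u a‖ ^ 2)
    (hτ : 0 ≤ τ) (h : ∑ a, ∑ b, ‖inner 𝕜 (u a) (u b)‖ ^ 2 ≤ τ ^ 2) :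
    𝔼 ω : A × Fin k → Bool, gramDefect 𝕜 (signedSum 𝕜 u ω) ρ ≤ k ^ 2 * (2 * τ) := by
  simp only [gramDefect, hρ]
  rw [expect_sum_comm]
  simp only [expect_sum_comm]
  calc _ ≤ ∑ _j : Fin k, ∑ _l : Fin k, 2 * τ := sum_le_sum fun j _ => sum_le_sum fun l _ =>
        expect_norm_inner_signedSum_sub_le' u j l hτ h
    _ = _ := by simp; ring

/-- The bound in `exists_contraction_comp_synthesis`. -/
noncomputable def inversionDefect (𝕜 : Type*) [RCLike 𝕜] [InnerProductSpace 𝕜 F] (v : Fin k → F)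
    (ρ : ℝ) : ℝ :=
  2 * ρ * gramDefect 𝕜 v ρ / (ρ ^ 2 + gramDefect 𝕜 v ρ)

lemma inversionDefect_nonneg (v : Fin k → F) {ρ : ℝ} (hρ : 0 ≤ ρ) :
    0 ≤ inversionDefect 𝕜 v ρ := by
  have := gramDefect_nonneg (𝕜 := 𝕜) v ρ
  unfold inversionDefect
  positivity

lemma inversionDefect_le_two_mul (v : Fin k → F) {ρ : ℝ} (hρ : 0 ≤ ρ) :
    inversionDefect 𝕜 v ρ ≤ 2 * ρ := by
  have := gramDefect_nonneg (𝕜 := 𝕜) v ρ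
  refine div_le_of_le_mul₀ (by positivity) (by positivity) ?_
  gcongr
  exact le_add_of_nonneg_left (sq_nonneg ρ)

lemma expect_inversionDefect_le {Ω : Type*} [Fintype Ω] (v : Ω → Fin k → F) {ρ c : ℝ} (hρ : 0 ≤ ρ)
    (hc : 0 ≤ c) (h : 𝔼 ω, gramDefect 𝕜 (v ω) ρ ≤ c * ρ) :
    𝔼 ω, inversionDefect 𝕜 (v ω) ρ ≤ 2 * c := by
  rcases hρ.eq_or_lt with rfl | h0
  · simpa [inversionDefect] using hc
  calc _ ≤ 𝔼 ω, 2 / ρ * gramDefect 𝕜 (v ω) ρ := expect_le_expect fun ω _ => by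
        have := gramDefect_nonneg (𝕜 := 𝕜) (v ω) ρ
        rw [inversionDefect, div_le_iff₀ (by positivity)]
        field_simp
        nlinarith [mul_nonneg this this]
    _ = 2 / ρ * 𝔼 ω, gramDefect 𝕜 (v ω) ρ := by rw [mul_expect]
    _ ≤ 2 / ρ * (c * ρ) := by gcongr
    _ = _ := by field_simp

lemma hasSum_expect {ι Ω : Type*} [Fintype Ω] {f : Ω → ι → ℝ} {s : Ω → ℝ}
    (h : ∀ ω, HasSum (f ω) (s ω)) : HasSum (fun i => 𝔼 ω, f ω i) (𝔼 ω, s ω) := by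
  simp only [Finset.expect]
  exact (hasSum_sum fun ω _ => h ω).const_smul _

variable {H : Type*} [NormedAddCommGroup H] [InnerProductSpace 𝕜 H]
  {ι : Type*} {E : ι → Type*} [∀ i, NormedAddCommGroup (E i)]
  [∀ i, InnerProductSpace 𝕜 (E i)]

lemma summable_sqrt_sum_sq (T : H →L[𝕜] lp E 1) {B : ℝ} (hT : ‖T‖ ≤ B) (w : A → H)
    (hw : ∑ a, ‖w a‖ ^ 2 = 1) :
    ∃ s, HasSum (fun i => √(∑ a, ‖T (w a) i‖ ^ 2)) s ∧ s ≤ 2 * B := by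
  have h1 : HasSum (fun i => 2 * 𝔼 ω : A × Fin 1 → Bool, ‖T (signedSum 𝕜 w ω 0) i‖)
      (2 * 𝔼 ω : A × Fin 1 → Bool, ‖T (signedSum 𝕜 w ω 0)‖) :=
    (hasSum_expect fun ω => hasSum_norm_coord _).mul_left _
  have h2 : ∀ i, √(∑ a, ‖T (w a) i‖ ^ 2) ≤
      2 * 𝔼 ω : A × Fin 1 → Bool, ‖T (signedSum 𝕜 w ω 0) i‖ := fun i => by
    refine (sqrt_sum_sq_le_expect_norm_signedSum (𝕜 := 𝕜) (fun a => T (w a) i) (0 : Fin 1)).trans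
      (le_of_eq ?_)
    congr 1
    refine expect_congr rfl fun ω _ => ?_
    exact congrArg norm
      (map_signedSum ((lp.evalCLM 𝕜 E 1 i ∘L T : H →L[𝕜] E i) : H →ₗ[𝕜] E i) w ω 0).symm
  have h3 : Summable fun i => √(∑ a, ‖T (w a) i‖ ^ 2) :=
    h1.summable.of_nonneg_of_le (fun i => Real.sqrt_nonneg _) h2
  refine ⟨_, h3.hasSum, (hasSum_le h2 h3.hasSum h1).trans ?_⟩
  gcongr
  have hB : 0 ≤ B := (norm_nonneg _).trans hT
  calc _ ≤ 𝔼 ω : A × Fin 1 → Bool, B * ((1 + ‖signedSum 𝕜 w ω 0‖ ^ 2) / 2) :=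
        expect_le_expect fun ω _ => (T.le_of_opNorm_le hT _).trans (by
          gcongr
          nlinarith [sq_nonneg (‖signedSum 𝕜 w ω 0‖ - 1)])
    _ = B := by
        rw [← mul_expect, ← expect_div, expect_add_distrib, expect_norm_signedSum_sq, hw]
        simp

/-- Random signs produce an almost isometric embedding on which `T` can be almost inverted. -/
lemma exists_almost_inverse [DecidableEq ι] [∀ i, CompleteSpace (E i)] (T : H →L[𝕜] lp E 1) {B : ℝ}
    (hT : ‖T‖ ≤ B) (w : A → H) (hw : ∑ a, ‖w a‖ ^ 2 = 1) {β : ℝ} (hβ0 : 0 ≤ β)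
    (hβ : ∀ y, ∑ a, ‖inner 𝕜 (w a) y‖ ^ 2 ≤ β ^ 2 * ‖y‖ ^ 2) (K : ∀ i, Submodule 𝕜 (E i))
    {η : ℝ} (hη0 : 0 ≤ η) (hη : ∀ i, ∀ y ∈ (K i)ᗮ, ∑ a, ‖inner 𝕜 (T (w a) i) y‖ ^ 2 ≤
      η ^ 2 * (∑ a, ‖T (w a) i‖ ^ 2) * ‖y‖ ^ 2) (k : ℕ) :
    ∃ (σ : ℝ) (V : EuclideanSpace 𝕜 (Fin k) →L[𝕜] H) (W : lp E 1 →L[𝕜] EuclideanSpace 𝕜 (Fin k)),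
      HasSum (fun i => √(∑ a, ‖(K i)ᗮ.starProjection (T (w a) i)‖ ^ 2)) σ ∧
      ‖V‖ ≤ √(1 + (2 * k ^ 2 * β + 8 * k ^ 2 * η * B)) ∧ ‖W‖ ≤ 1 ∧
      ∀ x, ‖W (T (V x)) - (σ : 𝕜) • x‖ ≤ (2 * k ^ 2 * β + 8 * k ^ 2 * η * B) * ‖x‖ := by
  set P : ∀ i, E i →L[𝕜] E i := fun i => (K i)ᗮ.starProjection with hP
  have hPn : ∀ i y, ‖P i y‖ ≤ ‖y‖ := fun i y => Submodule.norm_starProjection_apply_le _ y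
  set s : ι → ℝ := fun i => √(∑ a, ‖T (w a) i‖ ^ 2) with hs
  have hs0 : ∀ i, 0 ≤ s i := fun i => Real.sqrt_nonneg _
  have hs2 : ∀ i, s i ^ 2 = ∑ a, ‖T (w a) i‖ ^ 2 := fun i => Real.sq_sqrt (by positivity)
  set r : ι → ℝ := fun i => √(∑ a, ‖P i (T (w a) i)‖ ^ 2) with hr
  have hr0 : ∀ i, 0 ≤ r i := fun i => Real.sqrt_nonneg _
  have hr2 : ∀ i, r i ^ 2 = ∑ a, ‖P i (T (w a) i)‖ ^ 2 := fun i => Real.sq_sqrt (by positivity)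
  obtain ⟨t, ht, htB⟩ := summable_sqrt_sum_sq T hT w hw
  have hrs : ∀ i, r i ≤ s i := fun i => Real.sqrt_le_sqrt (sum_le_sum fun a _ => by
    gcongr
    exact hPn i _)
  have hσ : Summable r := ht.summable.of_nonneg_of_le hr0 hrs
  let R : ∀ i, H →L[𝕜] E i := fun i => P i ∘L lp.evalCLM 𝕜 E 1 i ∘L T
  have hRi : ∀ i a b, inner 𝕜 (P i (T (w a) i)) (P i (T (w b) i)) =
      inner 𝕜 (T (w a) i) (P i (T (w b) i)) := fun i a b => by
    rw [hP]
    exact Submodule.inner_starProjection_left_eq_right _ _ _ |>.trans (by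
      rw [Submodule.starProjection_eq_self_iff.2 (Submodule.starProjection_apply_mem _ _)])
  let e : ι → (A × Fin k → Bool) → ℝ := fun i ω =>
    inversionDefect 𝕜 (signedSum 𝕜 (fun a => P i (T (w a) i)) ω) (r i)
  have he0 : ∀ i ω, 0 ≤ e i ω := fun i ω => inversionDefect_nonneg _ (hr0 i)
  have hes : ∀ ω, Summable fun i => e i ω := fun ω =>
    (hσ.mul_left 2).of_nonneg_of_le (fun i => he0 i ω) fun i => inversionDefect_le_two_mul _ (hr0 i)
  have heE : ∀ i, 𝔼 ω, e i ω ≤ 4 * k ^ 2 * η * s i := fun i => by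
    have h1 : ∑ a, ∑ b, ‖inner 𝕜 (P i (T (w a) i)) (P i (T (w b) i))‖ ^ 2 ≤
        (η * s i * r i) ^ 2 := by
      refine (sum_norm_inner_sq_le (c := (η * s i) ^ 2) (hr2 i).symm fun b => ?_).trans_eq (by ring)
      simp only [hRi]
      refine (hη i _ (Submodule.starProjection_apply_mem _ _)).trans_eq ?_
      rw [← hs2]
      ring
    have h2 := expect_gramDefect_signedSum_le (k := k) _ (hr2 i)
      (mul_nonneg (mul_nonneg hη0 (hs0 i)) (hr0 i)) h1
    refine (expect_inversionDefect_le (𝕜 := 𝕜) (c := 2 * k ^ 2 * η * s i) _ (hr0 i)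
      (mul_nonneg (by positivity) (hs0 i)) (h2.trans_eq (by ring))).trans_eq (by ring)
  have hY : 𝔼 ω : A × Fin k → Bool, gramDefect 𝕜 (signedSum 𝕜 w ω) 1 ≤ 2 * k ^ 2 * β := by
    refine (expect_gramDefect_signedSum_le (k := k) (𝕜 := 𝕜) w (ρ := 1) (by rw [hw, one_pow]) hβ0
      ((sum_norm_inner_sq_le hw fun b => hβ _).trans_eq (mul_one _))).trans_eq (by ring)
  have htot : 𝔼 ω : A × Fin k → Bool, (gramDefect 𝕜 (signedSum 𝕜 w ω) 1 + ∑' i, e i ω) ≤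
      2 * k ^ 2 * β + 8 * k ^ 2 * η * B := by
    rw [expect_add_distrib]
    refine add_le_add hY ((hasSum_le heE (hasSum_expect fun ω => (hes ω).hasSum)
      (ht.mul_left _)).trans ?_)
    calc 4 * k ^ 2 * η * t ≤ 4 * k ^ 2 * η * (2 * B) := by gcongr
      _ = _ := by ring
  obtain ⟨ω, -, hω⟩ := exists_le_of_expect_le (univ_nonempty (α := A × Fin k → Bool))
    (htot.trans_eq (expect_const (univ_nonempty (α := A × Fin k → Bool)) _).symm)
  rw [expect_const (univ_nonempty (α := A × Fin k → Bool))] at hω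
  set δ := 2 * k ^ 2 * β + 8 * k ^ 2 * η * B
  have hY0 : gramDefect 𝕜 (signedSum 𝕜 w ω) 1 ≤ δ := by
    have : 0 ≤ ∑' i, e i ω := tsum_nonneg fun i => he0 i ω
    linarith
  have he' : ∑' i, e i ω ≤ δ := by
    linarith [gramDefect_nonneg (𝕜 := 𝕜) (signedSum 𝕜 w ω) 1]
  choose W₀ hW₀ hW₀' using fun i => exists_contraction_comp_synthesis (𝕜 := 𝕜)
    (signedSum 𝕜 (fun a => P i (T (w a) i)) ω) (hr0 i)
  obtain ⟨W, hW, -, hWs⟩ := exists_desc (E := E) zero_le_one (fun i => W₀ i ∘L P i) fun i =>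
    ((W₀ i).opNorm_comp_le _).trans (mul_le_one₀ (hW₀ i) (norm_nonneg _)
      (Submodule.starProjection_norm_le _))
  refine ⟨_, synthesis 𝕜 (signedSum 𝕜 w ω), W, hσ.hasSum, ?_, hW, fun x => ?_⟩
  · refine (norm_synthesis_le _ 1).trans (Real.sqrt_le_sqrt ?_)
    rw [one_pow]
    gcongr
  · have h1 : HasSum (fun i => W₀ i (P i (T (synthesis 𝕜 (signedSum 𝕜 w ω) x) i)) - (r i : 𝕜) • x)
        (W (T (synthesis 𝕜 (signedSum 𝕜 w ω) x)) - ((∑' i, r i : ℝ) : 𝕜) • x) :=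
      (hWs _).sub (((RCLike.hasSum_ofReal 𝕜).2 hσ.hasSum).smul_const x)
    refine (h1.norm_le_of_bounded ((hes ω).hasSum.mul_right ‖x‖) fun i => ?_).trans (by gcongr)
    have h2 : P i (T (synthesis 𝕜 (signedSum 𝕜 w ω) x) i) =
        synthesis 𝕜 (signedSum 𝕜 (fun a => P i (T (w a) i)) ω) x := by
      refine (map_synthesis (R i : H →ₗ[𝕜] E i) _ _).trans ?_
      congr 2
      ext j
      exact map_signedSum (R i : H →ₗ[𝕜] E i) w ω j
    rw [h2]
    exact hW₀' i x

end RandomEmbedding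

section FiniteFamily

open Finset

variable {𝕜 : Type*} [RCLike 𝕜] {H : Type*} [NormedAddCommGroup H] [InnerProductSpace 𝕜 H]
  {Y : Type*} [NormedAddCommGroup Y] [NormedSpace 𝕜 Y]

lemma exists_factors_of_no_orthonormal [CompleteSpace Y] (D : H →L[𝕜] Y) {N : ℕ} {c : ℝ}
    (hc : 0 ≤ c) (h : ∀ x : Fin N → H, Orthonormal 𝕜 x → ∑ i, ‖D (x i)‖ < N * c) :
    ∃ S : H →L[𝕜] Y, FactorsThroughEllOne (N * ‖D‖) S ∧ ‖D - S‖ ≤ c := by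
  rcases exists_orthonormal_or_exists_submodule (𝕜 := 𝕜) (fun x => c ≤ ‖D x‖) N with
    ⟨v, hv, hp⟩ | ⟨K, hK, hN, hp⟩
  · refine absurd (h v hv) (not_lt.2 ?_)
    simpa using sum_le_sum fun i (_ : i ∈ univ) => hp i
  refine ⟨D ∘L K.starProjection, .comp_starProjection K hN D, ?_⟩
  refine ContinuousLinearMap.opNorm_le_bound _ hc fun x => ?_
  have h1 : (D - D ∘L K.starProjection) x = D (Kᗮ.starProjection x) := by
    rw [sub_apply, ContinuousLinearMap.comp_apply, ← map_sub,
      K.starProjection_orthogonal_val]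
  rw [h1]
  set y := Kᗮ.starProjection x with hy
  have hyx : ‖y‖ ≤ ‖x‖ := Submodule.norm_starProjection_apply_le _ x
  rcases eq_or_ne y 0 with h0 | h0
  · rw [h0, map_zero, norm_zero]; positivity
  have h2 := hp (((‖y‖⁻¹ : ℝ) : 𝕜) • y)
    (Submodule.smul_mem _ _ (Submodule.starProjection_apply_mem _ _))
    (by rw [norm_smul, RCLike.norm_ofReal, abs_of_nonneg (by positivity),
      inv_mul_cancel₀ (norm_ne_zero_iff.2 h0)])
  rw [map_smul, norm_smul, RCLike.norm_ofReal, abs_of_nonneg (by positivity), not_le,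
    inv_mul_lt_iff₀ (norm_pos_iff.2 h0)] at h2
  exact h2.le.trans (by rw [mul_comm]; gcongr)

lemma exists_finite_family [FiniteDimensional 𝕜 H] (𝒮 : Set (H →L[𝕜] Y)) (hne : 𝒮.Nonempty)
    (hconv : ∀ S₁ ∈ 𝒮, ∀ S₂ ∈ 𝒮, ∀ a b : ℝ, 0 ≤ a → 0 ≤ b → a + b = 1 →
      (a : 𝕜) • S₁ + (b : 𝕜) • S₂ ∈ 𝒮) {B : ℝ} (hB : ∀ S ∈ 𝒮, ‖S‖ ≤ B) {N : ℕ} (hN : N ≠ 0)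
    {c ε : ℝ} (hε : 0 < ε)
    (h : ∀ S ∈ 𝒮, ∃ x : Fin N → H, Orthonormal 𝕜 x ∧ N * c ≤ ∑ i, ‖S (x i)‖) :
    ∃ (t : Finset (Fin N → H)) (w : t × Fin N → H) (q : t × Fin N → ℝ),
      ∑ a, q a ^ 2 = 1 ∧ ∑ a, ‖w a‖ ^ 2 = 1 ∧
      (∀ y, ∑ a, ‖inner 𝕜 (w a) y‖ ^ 2 ≤ ‖y‖ ^ 2 / N) ∧
      ∀ S ∈ 𝒮, c - ε ≤ ∑ a, q a * ‖S (w a)‖ := by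
  have hN' : (0 : ℝ) < N := by positivity
  have hB0 : 0 ≤ B := hne.elim fun S hS => (norm_nonneg S).trans (hB S hS)
  have : ProperSpace H := FiniteDimensional.proper_rclike 𝕜 H
  have htb : TotallyBounded {x : Fin N → H | Orthonormal 𝕜 x} :=
    (isCompact_closedBall (0 : Fin N → H) 1).totallyBounded.subset fun x hx => by
      rw [mem_closedBall_zero_iff, pi_norm_le_iff_of_nonneg zero_le_one]
      exact fun i => (hx.1 i).le
  obtain ⟨t', ht', htf, hcov⟩ := Metric.finite_approx_of_totallyBounded htb (ε / (B + 1))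
    (by positivity)
  lift t' to Finset (Fin N → H) using htf
  obtain ⟨μ, hμ0, hμ1, hμ⟩ := exists_weights hne
    (fun (ω : t') (S : H →L[𝕜] Y) => ∑ i, ‖S (ω.1 i)‖)
    (fun S₁ h₁ S₂ h₂ a b ha hb hab => ⟨_, hconv S₁ h₁ S₂ h₂ a b ha hb hab, fun ω => by
      rw [mul_sum, mul_sum, ← sum_add_distrib]
      refine sum_le_sum fun i _ => ?_
      rw [add_apply, smul_apply, smul_apply]
      refine (norm_add_le _ _).trans_eq ?_
      simp only [norm_smul, RCLike.norm_ofReal, abs_of_nonneg ha, abs_of_nonneg hb]⟩)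
    (c := N * (c - ε)) (fun S hS => by
      obtain ⟨x, hx, hxc⟩ := h S hS
      obtain ⟨y, hy, hxy⟩ := Set.mem_iUnion₂.1 (hcov hx)
      refine ⟨⟨y, hy⟩, ?_⟩
      have h1 : ∀ i, ‖S (x i)‖ ≤ ‖S (y i)‖ + ε := fun i => by
        have h2 : ‖x i - y i‖ ≤ ε / (B + 1) := by
          rw [← dist_eq_norm]
          exact (dist_le_pi_dist x y i).trans (Metric.mem_ball.1 hxy).le
        calc ‖S (x i)‖ = ‖S (y i) + S (x i - y i)‖ := by rw [← map_add, add_sub_cancel]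
          _ ≤ ‖S (y i)‖ + B * (ε / (B + 1)) := (norm_add_le _ _).trans (by
              gcongr
              exact (S.le_of_opNorm_le (hB S hS) _).trans (by gcongr))
          _ ≤ _ := by
              gcongr
              rw [mul_div_assoc', div_le_iff₀ (by positivity)]
              nlinarith
      calc N * (c - ε) ≤ ∑ i, ‖S (x i)‖ - N * ε := by linarith
        _ ≤ ∑ i, (‖S (y i)‖ + ε) - N * ε := by gcongr with i; exact h1 i
        _ = _ := by simp [sum_add_distrib])
  have hort : ∀ ω : t', Orthonormal 𝕜 ω.1 := fun ω => ht' ω.2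
  have hp : ∀ ω : t', √(μ ω / N) ^ 2 = μ ω / N := fun ω =>
    Real.sq_sqrt (div_nonneg (hμ0 ω) hN'.le)
  have hsum : ∑ a : t' × Fin N, √(μ a.1 / N) ^ 2 = 1 := by
    simp only [hp, Fintype.sum_prod_type, sum_const, card_univ, Fintype.card_fin, nsmul_eq_mul]
    rw [← mul_sum, ← sum_div, hμ1]
    field_simp
  refine ⟨t', fun a => ((√(μ a.1 / N) : ℝ) : 𝕜) • a.1.1 a.2, fun a => √(μ a.1 / N), hsum, ?_,
    fun y => ?_, fun S hS => ?_⟩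
  · rw [← hsum]
    refine sum_congr rfl fun a _ => ?_
    rw [norm_smul, (hort a.1).1 a.2, mul_one, RCLike.norm_ofReal, sq_abs]
  · simp only [inner_smul_left, norm_mul, RCLike.norm_conj, RCLike.norm_ofReal, mul_pow, sq_abs, hp,
      Fintype.sum_prod_type]
    calc _ = ∑ ω : t', μ ω / N * ∑ i, ‖inner 𝕜 (ω.1 i) y‖ ^ 2 := by simp only [mul_sum]
      _ ≤ ∑ ω : t', μ ω / N * ‖y‖ ^ 2 := by
        gcongr with ω
        · exact div_nonneg (hμ0 ω) hN'.le
        · exact (hort ω).sum_inner_products_le y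
      _ = _ := by rw [← sum_mul, ← sum_div, hμ1]; ring
  · have h1 : ∑ a : t' × Fin N, √(μ a.1 / N) * ‖S (((√(μ a.1 / N) : ℝ) : 𝕜) • a.1.1 a.2)‖ =
        (∑ ω, μ ω * ∑ i, ‖S (ω.1 i)‖) / N := by
      simp only [map_smul, norm_smul, RCLike.norm_ofReal, abs_of_nonneg (Real.sqrt_nonneg _),
        ← mul_assoc, ← sq, hp, Fintype.sum_prod_type, sum_div, mul_sum, div_mul_eq_mul_div]
    rw [h1, le_div_iff₀ hN', mul_comm]
    exact hμ S hS

end FiniteFamily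

section Dichotomy

open Finset

variable {𝕜 : Type*} [RCLike 𝕜] {ι : Type*} [DecidableEq ι] {E : ι → Type*}
  [∀ i, NormedAddCommGroup (E i)] [∀ i, InnerProductSpace 𝕜 (E i)]

lemma exists_blockProjection [Countable ι] [∀ i, CompleteSpace (E i)] (K : ∀ i, Submodule 𝕜 (E i))
    [∀ i, FiniteDimensional 𝕜 (K i)] {N : ℕ} (hN : ∀ i, Module.finrank 𝕜 (K i) ≤ N) :
    ∃ Q : lp E 1 →L[𝕜] lp E 1, FactorsThroughEllOne N Q ∧
      ∀ x i, x i - Q x i = (K i)ᗮ.starProjection (x i) := by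
  obtain ⟨Q, -, hQs, hQ⟩ := exists_desc (𝕜 := 𝕜) (E := E) zero_le_one
    (fun i => lp.singleContinuousLinearMap 𝕜 E 1 i ∘L (K i).starProjection) fun i =>
      ContinuousLinearMap.opNorm_le_bound _ zero_le_one fun x => by
        simpa using Submodule.norm_starProjection_apply_le _ x
  refine ⟨Q, .of_single (by positivity) _ fun i => ?_, fun x i => ?_⟩
  · have h1 : Q ∘L lp.singleContinuousLinearMap 𝕜 E 1 i =
        lp.singleContinuousLinearMap 𝕜 E 1 i ∘L (K i).starProjection := by
      ext1 x
      simpa using hQs i x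
    rw [h1]
    refine (FactorsThroughEllOne.comp_starProjection (K i) (hN i) _).mono
      (mul_le_of_le_one_right (by positivity) ?_)
    exact ContinuousLinearMap.opNorm_le_bound _ zero_le_one fun x => by simp
  · have h1 := (hQ x).mapL (lp.evalCLM 𝕜 E 1 i)
    have h2 := h1.unique (hasSum_single i fun j hj => by
      simp [lp.evalCLM, hj.symm])
    have h3 : Q x i = (K i).starProjection (x i) := by
      simpa [lp.evalCLM] using h2
    rw [h3, (K i).starProjection_orthogonal_val]

lemma exists_submodule_of_bessel {F : Type*} [NormedAddCommGroup F] [InnerProductSpace 𝕜 F]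
    {A : Type*} [Fintype A] (u : A → F) {N : ℕ} (hN : N ≠ 0) {η : ℝ} (hη : η ^ 2 * N = 1) :
    ∃ K : Submodule 𝕜 F, FiniteDimensional 𝕜 K ∧ Module.finrank 𝕜 K ≤ N ∧
      ∀ y ∈ Kᗮ, ∑ a, ‖inner 𝕜 (u a) y‖ ^ 2 ≤ η ^ 2 * (∑ a, ‖u a‖ ^ 2) * ‖y‖ ^ 2 := by
  rcases exists_orthonormal_or_exists_submodule (𝕜 := 𝕜)
    (fun y => η ^ 2 * (∑ a, ‖u a‖ ^ 2) < ∑ a, ‖inner 𝕜 (u a) y‖ ^ 2) N with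
    ⟨v, hv, hp⟩ | ⟨K, hK, hKN, hp⟩
  · exfalso
    have : Nonempty (Fin N) := ⟨⟨0, Nat.pos_of_ne_zero hN⟩⟩
    have h1 := sum_lt_sum_of_nonempty (univ_nonempty (α := Fin N)) fun i _ => hp i
    rw [sum_const, card_univ, Fintype.card_fin, nsmul_eq_mul, ← mul_assoc, mul_comm (N : ℝ), hη,
      one_mul, sum_comm] at h1
    refine absurd h1 (not_lt.2 (sum_le_sum fun a _ => ?_))
    simpa only [norm_inner_symm (u a)] using hv.sum_inner_products_le (u a) (s := univ)
  · refine ⟨K, hK, hKN, fun y hy => ?_⟩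
    rcases eq_or_ne y 0 with rfl | h0
    · simp
    have hy0 : 0 < ‖y‖ := norm_pos_iff.2 h0
    have h2 := hp (((‖y‖⁻¹ : ℝ) : 𝕜) • y) (Submodule.smul_mem _ _ hy)
      (by rw [norm_smul, RCLike.norm_ofReal, abs_of_nonneg (by positivity),
        inv_mul_cancel₀ hy0.ne'])
    simp only [inner_smul_right, norm_mul, RCLike.norm_ofReal, mul_pow, sq_abs, not_lt,
      ← mul_sum] at h2
    rwa [inv_pow, inv_mul_le_iff₀ (by positivity), mul_comm (‖y‖ ^ 2)] at h2

/-- Either `T` is close to an operator factoring through `ℓ₁`, or the identity of `𝕜ᵏ` almost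
factors through `T`. -/
lemma dichotomy {H : Type*} [NormedAddCommGroup H] [InnerProductSpace 𝕜 H]
    [FiniteDimensional 𝕜 H] [Countable ι] [∀ i, CompleteSpace (E i)] (T : H →L[𝕜] lp E 1)
    {B : ℝ} (hT : ‖T‖ ≤ B) {N : ℕ} (hN : N ≠ 0) {η : ℝ} (hη0 : 0 ≤ η) (hη : η ^ 2 * N = 1)
    {c ε : ℝ} (hc : 0 ≤ c) (hε : 0 < ε) (k : ℕ) :
    (∃ S, FactorsThroughEllOne (N * B + N * (B + N * B)) S ∧ ‖T - S‖ ≤ c) ∨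
    ∃ (σ : ℝ) (V : EuclideanSpace 𝕜 (Fin k) →L[𝕜] H) (W : lp E 1 →L[𝕜] EuclideanSpace 𝕜 (Fin k)),
      c - ε ≤ σ ∧ ‖V‖ ≤ √(1 + (2 * k ^ 2 * η + 8 * k ^ 2 * η * B)) ∧ ‖W‖ ≤ 1 ∧
      ∀ x, ‖W (T (V x)) - (σ : 𝕜) • x‖ ≤ (2 * k ^ 2 * η + 8 * k ^ 2 * η * B) * ‖x‖ := by
  have hB : 0 ≤ B := (norm_nonneg _).trans hT
  have hTS : ∀ S, FactorsThroughEllOne (N * B) S → ‖T - S‖ ≤ B + N * B := fun S hS =>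
    (norm_sub_le _ _).trans (add_le_add hT hS.norm_le)
  by_cases hcase : ∃ S : H →L[𝕜] lp E 1, FactorsThroughEllOne (N * B) S ∧
      ∀ x : Fin N → H, Orthonormal 𝕜 x → ∑ i, ‖(T - S) (x i)‖ < N * c
  · obtain ⟨S, hS, hS'⟩ := hcase
    obtain ⟨S₁, h1, h2⟩ := exists_factors_of_no_orthonormal (T - S) hc hS'
    refine Or.inl ⟨S + S₁, hS.add (h1.mono ?_), by rwa [← sub_sub]⟩
    gcongr
    exact hTS S hS
  push Not at hcase
  right
  obtain ⟨t, w, q, hq, hw, hb, hwq⟩ := exists_finite_family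
    {D : H →L[𝕜] lp E 1 | ∃ S, FactorsThroughEllOne (N * B) S ∧ D = T - S}
    ⟨T - 0, 0, FactorsThroughEllOne.zero.mono (by positivity), rfl⟩ (by
      rintro _ ⟨S₁, h₁, rfl⟩ _ ⟨S₂, h₂, rfl⟩ a b ha hb hab
      refine ⟨(a : 𝕜) • S₁ + (b : 𝕜) • S₂, ((h₁.smul _).add (h₂.smul _)).mono ?_, ?_⟩
      · rw [RCLike.norm_ofReal, RCLike.norm_ofReal, abs_of_nonneg ha, abs_of_nonneg hb, ← add_mul,
          hab, one_mul]
      · have : T = ((a : 𝕜) + (b : 𝕜)) • T := by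
          rw [← RCLike.ofReal_add, hab, RCLike.ofReal_one, one_smul]
        conv_rhs => rw [this]
        rw [smul_sub, smul_sub, add_smul]
        abel) (B := B + N * B) (by
      rintro _ ⟨S, hS, rfl⟩
      exact hTS S hS) hN hε (by
      rintro _ ⟨S, hS, rfl⟩
      exact hcase S hS)
  choose K hK hKN hKη using fun i => exists_submodule_of_bessel (𝕜 := 𝕜) (fun a => T (w a) i) hN hη
  obtain ⟨Q, hQ, hQ'⟩ := exists_blockProjection K hKN
  classical
  obtain ⟨σ, V, W, hσ, hV, hW, hWV⟩ := exists_almost_inverse T hT w hw hη0 (fun y => by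
    refine (hb y).trans_eq ?_
    rw [eq_div_of_mul_eq (by positivity) hη]
    ring) K hη0 hKη k
  refine ⟨σ, V, W, ?_, hV, hW, hWV⟩
  refine (hwq _ ⟨Q ∘L T, (hQ.comp_right T).mono (by gcongr), rfl⟩).trans ?_
  have h1 : HasSum (fun i => ∑ a, q a * ‖(K i)ᗮ.starProjection (T (w a) i)‖)
      (∑ a, q a * ‖(T - Q ∘L T) (w a)‖) :=
    hasSum_sum fun a _ => (by
      have := hasSum_norm_coord ((T - Q ∘L T) (w a))
      simpa [← hQ'] using this.mul_left (q a))
  refine hasSum_le (fun i => ?_) h1 hσ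
  refine (Real.sum_mul_le_sqrt_mul_sqrt _ _ _).trans_eq ?_
  rw [hq, Real.sqrt_one, one_mul]

end Dichotomy

section Blocks

open Finset Filter Topology

variable {𝕜 : Type*} [RCLike 𝕜]

lemma dichotomy_normalized {ι : Type*} [DecidableEq ι] {E : ι → Type*}
    [∀ i, NormedAddCommGroup (E i)] [∀ i, InnerProductSpace 𝕜 (E i)] [Countable ι]
    [∀ i, CompleteSpace (E i)] {B : ℝ} (hB : 0 ≤ B) {δ : ℝ} (hδ : 0 < δ) (hδ' : δ ≤ 1 / 4) (k : ℕ) :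
    ∃ M : ℝ, ∀ (n : ℕ) (T : EuclideanSpace 𝕜 (Fin n) →L[𝕜] lp E 1), ‖T‖ ≤ B →
      (∃ S, FactorsThroughEllOne M S ∧ ‖T - S‖ ≤ 1 - δ) ∨
      ∃ (V : EuclideanSpace 𝕜 (Fin k) →L[𝕜] EuclideanSpace 𝕜 (Fin n))
        (W : lp E 1 →L[𝕜] EuclideanSpace 𝕜 (Fin k)),
        ‖V‖ ≤ 1 + 4 * δ ∧ ‖W‖ ≤ 1 + 4 * δ ∧ ∀ x, ‖W (T (V x)) - x‖ ≤ 4 * δ * ‖x‖ := by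
  set D : ℝ := 2 * k ^ 2 + 8 * k ^ 2 * B with hD
  have hD0 : 0 ≤ D := by positivity
  obtain ⟨N, hN⟩ := exists_nat_gt (((D + 1) / δ) ^ 2)
  have hN0 : (0 : ℝ) < N := (sq_nonneg _).trans_lt hN
  have hs : (D + 1) / δ ≤ √N := Real.le_sqrt_of_sq_le hN.le
  have hs0 : 0 < √N := Real.sqrt_pos.2 hN0
  have hη : 2 * k ^ 2 * (√N)⁻¹ + 8 * k ^ 2 * (√N)⁻¹ * B ≤ δ := by
    rw [div_le_iff₀ hδ] at hs
    have : 2 * k ^ 2 * (√N)⁻¹ + 8 * k ^ 2 * (√N)⁻¹ * B = D / √N := by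
      rw [hD]; ring
    rw [this, div_le_iff₀ hs0]
    linarith
  refine ⟨N * B + N * (B + N * B), fun n T hT => ?_⟩
  refine (dichotomy T hT (N := N) (by rintro rfl; simp at hN0) (inv_nonneg.2 hs0.le)
    (by rw [inv_pow, Real.sq_sqrt hN0.le, inv_mul_cancel₀ hN0.ne']) (c := 1 - δ) (by linarith)
    hδ k).imp id ?_
  rintro ⟨σ, V, W, hσ, hV, hW, h⟩
  have hσ0 : 0 < σ := by linarith
  have hσ1 : σ⁻¹ ≤ 1 + 4 * δ := by
    rw [inv_le_iff_one_le_mul₀ hσ0]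
    nlinarith
  refine ⟨V, ((σ⁻¹ : ℝ) : 𝕜) • W, hV.trans ?_, ?_, fun x => ?_⟩
  · rw [Real.sqrt_le_left (by linarith)]
    nlinarith
  · rw [norm_smul, RCLike.norm_ofReal, abs_of_nonneg (by positivity)]
    nlinarith [inv_pos.2 hσ0, norm_nonneg W]
  · have h1 : (((σ⁻¹ : ℝ) : 𝕜) • W) (T (V x)) - x =
        ((σ⁻¹ : ℝ) : 𝕜) • (W (T (V x)) - (σ : 𝕜) • x) := by
      rw [smul_sub, smul_smul, ← RCLike.ofReal_mul, inv_mul_cancel₀ hσ0.ne', RCLike.ofReal_one,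
        one_smul, smul_apply]
    rw [h1, norm_smul, RCLike.norm_ofReal, abs_of_nonneg (by positivity)]
    calc σ⁻¹ * ‖W (T (V x)) - (σ : 𝕜) • x‖ ≤ (1 + 4 * δ) * (δ * ‖x‖) := by
          gcongr
          exact (h x).trans (by gcongr)
      _ = ((1 + 4 * δ) * δ) * ‖x‖ := by ring
      _ ≤ _ := by gcongr; nlinarith

lemma exists_isometry_comp_eq_zero {F G : Type*} [NormedAddCommGroup F] [InnerProductSpace 𝕜 F]
    [FiniteDimensional 𝕜 F] [AddCommGroup G] [Module 𝕜 G] [Module.Finite 𝕜 G] (L : F →ₗ[𝕜] G)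
    {k : ℕ} (hk : k + Module.finrank 𝕜 G ≤ Module.finrank 𝕜 F) :
    ∃ (J : EuclideanSpace 𝕜 (Fin k) →L[𝕜] F) (P : F →L[𝕜] EuclideanSpace 𝕜 (Fin k)),
      ‖J‖ ≤ 1 ∧ ‖P‖ ≤ 1 ∧ (∀ x, P (J x) = x) ∧ ∀ x, L (J x) = 0 := by
  have := FiniteDimensional.complete 𝕜 F
  have h1 := L.finrank_range_add_finrank_ker
  have h2 := (LinearMap.range L).finrank_le
  let b := stdOrthonormalBasis 𝕜 (LinearMap.ker L)
  let v : Fin k → F := fun j => b (Fin.castLE (by omega) j)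
  have hv : Orthonormal 𝕜 v := (b.orthonormal.comp_linearIsometry
    (LinearMap.ker L).subtypeₗᵢ).comp _ (Fin.castLE_injective _)
  have hv0 : gramDefect 𝕜 v 1 = 0 := by
    rw [gramDefect]
    refine sum_eq_zero fun i _ => sum_eq_zero fun j _ => ?_
    rw [orthonormal_iff_ite.1 hv i j]
    simp
  obtain ⟨P, hP, hP'⟩ := exists_contraction_comp_synthesis (𝕜 := 𝕜) v zero_le_one
  refine ⟨synthesis 𝕜 v, P, ?_, hP, fun x => ?_, fun x => ?_⟩
  · simpa [hv0] using norm_synthesis_le (𝕜 := 𝕜) v 1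
  · have := hP' x
    simpa [hv0, sub_eq_zero] using this
  · rw [synthesis_apply, map_sum]
    exact sum_eq_zero fun j _ => by
      rw [map_smul, show L (v j) = 0 from LinearMap.mem_ker.1 (b _).2, smul_zero]

variable {E : ℕ → Type*} [∀ i, NormedAddCommGroup (E i)] [∀ i, InnerProductSpace 𝕜 (E i)]

lemma hasSum_norm_tail (y : lp E 1) (b : ℕ) :
    HasSum (fun m => if m < b then 0 else ‖y m‖) (‖y‖ - ∑ m ∈ range b, ‖y m‖) := by
  have h1 : HasSum (fun m => if m < b then ‖y m‖ else 0) (∑ m ∈ range b, ‖y m‖) := by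
    have : ∑ m ∈ range b, ‖y m‖ = ∑ m ∈ range b, if m < b then ‖y m‖ else 0 :=
      sum_congr rfl fun m hm => by rw [if_pos (mem_range.1 hm)]
    rw [this]
    exact hasSum_sum_of_ne_finset_zero fun m hm => if_neg fun h => hm (mem_range.2 h)
  have h2 : (fun m => if m < b then 0 else ‖y m‖) =
      fun m => ‖y m‖ - if m < b then ‖y m‖ else 0 := by
    ext m
    split_ifs <;> simp
  rw [h2]
  exact (hasSum_norm_coord y).sub h1

lemma exists_uniform_tail {k : ℕ} (Z : EuclideanSpace 𝕜 (Fin k) →L[𝕜] lp E 1) {δ : ℝ}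
    (hδ : 0 < δ) (a : ℕ) :
    ∃ b, a < b ∧ ∀ x, ‖Z x‖ - ∑ m ∈ range b, ‖Z x m‖ ≤ δ * ‖x‖ := by
  have h1 : ∀ y : lp E 1, ∀ᶠ b in atTop, ‖y‖ - ∑ m ∈ range b, ‖y m‖ < δ / (k + 1) := fun y => by
    have : Tendsto (fun b => ‖y‖ - ∑ m ∈ range b, ‖y m‖) atTop (𝓝 (‖y‖ - ‖y‖)) :=
      tendsto_const_nhds.sub (hasSum_norm_coord y).tendsto_sum_nat
    rw [sub_self] at this
    exact this.eventually_lt_const (by positivity)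
  have h2 : ∀ᶠ b in atTop, ∀ j : Fin k, ‖Z (EuclideanSpace.single j 1)‖ -
      ∑ m ∈ range b, ‖Z (EuclideanSpace.single j 1) m‖ < δ / (k + 1) :=
    eventually_all.2 fun j => h1 _
  obtain ⟨b, hb, hab⟩ := (h2.and (eventually_gt_atTop a)).exists
  refine ⟨b, hab, fun x => ?_⟩
  have hx : Z x = ∑ j, x j • Z (EuclideanSpace.single j 1) := by
    conv_lhs => rw [← (EuclideanSpace.basisFun (Fin k) 𝕜).sum_repr x]
    simp
  have h3 := hasSum_sum fun j (_ : j ∈ univ) =>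
    (hasSum_norm_tail (Z (EuclideanSpace.single j 1)) b).mul_left ‖x j‖
  refine (hasSum_le (fun m => ?_) (hasSum_norm_tail (Z x) b) h3).trans ?_
  · dsimp only
    split_ifs with hm
    · simp
    · have hxm := (congrArg (lp.evalCLM 𝕜 E 1 m) hx).trans (map_sum _ _ _)
      refine (congrArg norm hxm).trans_le ((norm_sum_le _ _).trans_eq (sum_congr rfl fun j _ => ?_))
      rw [map_smul, norm_smul]
      rfl
  · calc _ ≤ ∑ _j : Fin k, ‖x‖ * (δ / (k + 1)) := by
          gcongr with j
          · exact sub_nonneg.2 (sum_le_hasSum _ (fun _ _ => norm_nonneg _) (hasSum_norm_coord _))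
          · exact PiLp.norm_apply_le x j
          · exact (hb j).le
      _ = (k / (k + 1) : ℝ) * (δ * ‖x‖) := by simp; ring
      _ ≤ 1 * (δ * ‖x‖) := by
          gcongr
          rw [div_le_one (by positivity)]
          linarith
      _ = _ := one_mul _

lemma exists_block [∀ i, FiniteDimensional 𝕜 (E i)] {X : Type*} [NormedAddCommGroup X]
    [NormedSpace 𝕜 X] (T : X →L[𝕜] lp E 1) {C δ : ℝ} (hδ : 0 < δ)
    (h : ∀ k, ∃ (V : EuclideanSpace 𝕜 (Fin k) →L[𝕜] X) (W : lp E 1 →L[𝕜] EuclideanSpace 𝕜 (Fin k)),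
      ‖V‖ ≤ C ∧ ‖W‖ ≤ C ∧ ∀ x, ‖W (T (V x)) - x‖ ≤ δ * ‖x‖) (k a : ℕ) :
    ∃ (b : ℕ) (V : EuclideanSpace 𝕜 (Fin k) →L[𝕜] X) (W : lp E 1 →L[𝕜] EuclideanSpace 𝕜 (Fin k)),
      a < b ∧ ‖V‖ ≤ C ∧ ‖W‖ ≤ C ∧ (∀ x, ‖W (T (V x)) - x‖ ≤ δ * ‖x‖) ∧
      ∀ x, ∃ t, HasSum (fun m => if a ≤ m ∧ m < b then 0 else ‖T (V x) m‖) t ∧ t ≤ δ * ‖x‖ := by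
  obtain ⟨V, W, hV, hW, hWV⟩ := h (k + Module.finrank 𝕜 (∀ m : Fin a, E m))
  let L : EuclideanSpace 𝕜 (Fin (k + Module.finrank 𝕜 (∀ m : Fin a, E m))) →ₗ[𝕜]
      (∀ m : Fin a, E m) := LinearMap.pi fun m => (lp.evalCLM 𝕜 E 1 m ∘L T ∘L V).toLinearMap
  obtain ⟨J, P, hJ, hP, hPJ, hLJ⟩ := exists_isometry_comp_eq_zero L (k := k) (by simp)
  have hC : 0 ≤ C := (norm_nonneg _).trans hV
  have hJx : ∀ x, ‖J x‖ ≤ ‖x‖ := fun x => by simpa using J.le_of_opNorm_le hJ x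
  obtain ⟨b, hab, hb⟩ := exists_uniform_tail (T ∘L V ∘L J) hδ a
  refine ⟨b, V ∘L J, P ∘L W, hab, (V.opNorm_comp_le J).trans ?_, (P.opNorm_comp_le W).trans ?_,
    fun x => ?_, fun x => ⟨_, ?_, hb x⟩⟩
  · exact (mul_le_of_le_one_right (norm_nonneg _) hJ).trans hV
  · exact (mul_le_of_le_one_left (norm_nonneg _) hP).trans hW
  · have h1 : (P ∘L W) (T ((V ∘L J) x)) - x = P (W (T (V (J x))) - J x) := by
      rw [map_sub, hPJ]; rfl
    rw [h1]
    calc _ ≤ 1 * (δ * ‖x‖) := P.le_of_opNorm_le_of_le hP ((hWV _).trans (by gcongr; exact hJx x))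
      _ = _ := one_mul _
  · have h1 : (fun m => if a ≤ m ∧ m < b then 0 else ‖T (V (J x)) m‖) =
        fun m => if m < b then 0 else ‖T (V (J x)) m‖ := by
      ext m
      by_cases hm : m < a
      · have h2 : T (V (J x)) m = 0 := congrFun (hLJ x) ⟨m, hm⟩
        simp [h2]
      · simp [not_lt.1 hm]
    exact h1 ▸ hasSum_norm_tail (T (V (J x))) b

lemma exists_partition {a : ℕ → ℕ} (ha : StrictMono a) (h0 : a 0 = 0) :
    ∃ c : ℕ → ℕ, ∀ m k, a k ≤ m ∧ m < a (k + 1) ↔ c m = k := by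
  have hex : ∀ m, ∃ k, a k ≤ m ∧ m < a (k + 1) := fun m => by
    have hm : ∃ k, m < a (k + 1) := ⟨m, (Nat.lt_succ_self m).trans_le (ha.id_le _)⟩
    refine ⟨Nat.find hm, ?_, Nat.find_spec hm⟩
    rcases hk : Nat.find hm with _ | k
    · omega
    · exact not_lt.1 (Nat.find_min hm (hk ▸ k.lt_succ_self))
  choose c hc using hex
  refine ⟨c, fun m k => ⟨fun h => ?_, fun h => h ▸ hc m⟩⟩
  have h1 := ha.lt_iff_lt.1 ((hc m).1.trans_lt h.2)
  have h2 := ha.lt_iff_lt.1 (h.1.trans_lt (hc m).2)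
  omega

lemma exists_almost_identity [∀ i, FiniteDimensional 𝕜 (E i)] {X : Type*} [NormedAddCommGroup X]
    [NormedSpace 𝕜 X] [CompleteSpace X] (T : X →L[𝕜] lp E 1) {C δ : ℝ} (hδ : 0 < δ)
    (h : ∀ k, ∃ (V : EuclideanSpace 𝕜 (Fin k) →L[𝕜] X) (W : lp E 1 →L[𝕜] EuclideanSpace 𝕜 (Fin k)),
      ‖V‖ ≤ C ∧ ‖W‖ ≤ C ∧ ∀ x, ‖W (T (V x)) - x‖ ≤ δ * ‖x‖) :
    ∃ (V : lp (fun n : ℕ => EuclideanSpace 𝕜 (Fin n)) 1 →L[𝕜] X)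
      (U : lp E 1 →L[𝕜] lp (fun n : ℕ => EuclideanSpace 𝕜 (Fin n)) 1), ‖V‖ ≤ C ∧ ‖U‖ ≤ C ∧
      ‖U ∘L T ∘L V - ContinuousLinearMap.id 𝕜 (lp (fun n : ℕ => EuclideanSpace 𝕜 (Fin n)) 1)‖ ≤
        (2 * C + 1) * δ := by
  choose b V W hab hV hW hWV ht using exists_block T hδ h
  have hC : 0 ≤ C := (norm_nonneg _).trans (hV 0 0)
  let a : ℕ → ℕ := fun k => Nat.rec 0 (fun k a => b k a) k
  obtain ⟨c, hc⟩ := exists_partition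
    (strictMono_nat_of_lt_succ fun k => hab k (a k) : StrictMono a) rfl
  let I : ∀ k, EuclideanSpace 𝕜 (Fin k) →L[𝕜] lp (fun n : ℕ => EuclideanSpace 𝕜 (Fin n)) 1 :=
    lp.singleContinuousLinearMap 𝕜 _ 1
  have hI : ∀ k x, ‖I k x‖ = ‖x‖ := fun k x => by simp [I]
  have hWs : ∀ k m x, ‖I k (W k (a k) (lp.single 1 m x))‖ ≤ C * ‖x‖ := fun k m x => by
    rw [hI]
    refine ((W k (a k)).le_of_opNorm_le (hW k (a k)) _).trans_eq ?_
    rw [lp.norm_single (by simp)]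
  obtain ⟨V', hV', hV'e, -⟩ := exists_desc (E := fun n : ℕ => EuclideanSpace 𝕜 (Fin n)) hC
    (fun k => V k (a k)) fun k => hV k (a k)
  obtain ⟨U, hU, -, hUs⟩ := exists_desc (E := E) hC
    (fun m => I (c m) ∘L W (c m) (a (c m)) ∘L lp.singleContinuousLinearMap 𝕜 E 1 m)
    fun m => ContinuousLinearMap.opNorm_le_bound _ hC fun x => hWs _ _ _
  refine ⟨V', U, hV', hU, opNorm_le_of_single (by positivity) _ fun k x => ?_⟩
  obtain ⟨t, hts, htx⟩ := ht k (a k) x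
  have h1 : HasSum (fun m => I k (W k (a k) (lp.single 1 m (T (V k (a k) x) m))))
      (I k (W k (a k) (T (V k (a k) x)))) :=
    (lp.hasSum_single (p := 1) (by simp) (T (V k (a k) x))).mapL (I k ∘L W k (a k))
  have h2 := (hUs (T (V k (a k) x))).sub h1
  have h3 : ‖U (T (V k (a k) x)) - I k (W k (a k) (T (V k (a k) x)))‖ ≤ 2 * C * t := by
    refine h2.norm_le_of_bounded (hts.mul_left (2 * C)) fun m => ?_
    rcases Classical.em (a k ≤ m ∧ m < b k (a k)) with hm | hm
    · rw [if_pos hm]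
      obtain rfl := (hc m k).1 hm
      simp
    · rw [if_neg hm]
      refine (norm_sub_le _ _).trans ((add_le_add (hWs _ _ _) (hWs _ _ _)).trans_eq ?_)
      ring
  have h4 : (U ∘L T ∘L V' - ContinuousLinearMap.id 𝕜
      (lp (fun n : ℕ => EuclideanSpace 𝕜 (Fin n)) 1)) (lp.single 1 k x) =
      (U (T (V k (a k) x)) - I k (W k (a k) (T (V k (a k) x)))) +
        I k (W k (a k) (T (V k (a k) x)) - x) := by
    rw [map_sub, ← hV'e]
    simp [I]
  rw [h4]
  refine (norm_add_le _ _).trans ?_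
  rw [hI]
  calc _ ≤ 2 * C * (δ * ‖x‖) + δ * ‖x‖ := add_le_add (h3.trans (by gcongr)) (hWV k (a k) x)
    _ = _ := by ring

end Blocks

section Main

variable {𝕜 : Type*} [RCLike 𝕜]

lemma exists_leftInverse_of_norm_sub_id_le {X : Type*} [NormedAddCommGroup X] [NormedSpace 𝕜 X]
    [CompleteSpace X] (A : X →L[𝕜] X) {ε : ℝ} (hε : ε < 1)
    (hA : ‖A - ContinuousLinearMap.id 𝕜 X‖ ≤ ε) :
    ∃ B : X →L[𝕜] X, B ∘L A = ContinuousLinearMap.id 𝕜 X ∧ ‖B‖ ≤ (1 - ε)⁻¹ := by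
  have h1 : ‖1 - A‖ ≤ ε := by rwa [norm_sub_rev]
  let u := Units.oneSub (1 - A) (h1.trans_lt hε)
  have hu : (u : X →L[𝕜] X) = A := sub_sub_cancel 1 A
  let B : X →L[𝕜] X := ↑u⁻¹
  have hB : B * A = 1 := by rw [← hu]; exact u.inv_mul
  refine ⟨B, hB, ?_⟩
  have h2 : B = 1 + B * (1 - A) := by rw [mul_sub, hB]; simp
  have h3 : ‖B‖ ≤ 1 + ‖B‖ * ε := by
    calc ‖B‖ = ‖1 + B * (1 - A)‖ := congrArg norm h2
      _ ≤ ‖(1 : X →L[𝕜] X)‖ + ‖B * (1 - A)‖ := norm_add_le _ _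
      _ ≤ 1 + ‖B‖ * ‖1 - A‖ := add_le_add ContinuousLinearMap.norm_id_le (norm_mul_le _ _)
      _ ≤ _ := by gcongr
  rw [← one_div, le_div_iff₀ (sub_pos.2 hε)]
  linarith

/-- An operator on `(⊕ ℓ₂ⁿ)_{ℓ₁}` at distance at least one from the operators factoring through
`ℓ₁` preserves almost isometric copies of every finite-dimensional Euclidean space. -/
lemma exists_euclidean_copy
    (T : lp (fun n : ℕ => EuclideanSpace 𝕜 (Fin n)) 1 →L[𝕜]
      lp (fun n : ℕ => EuclideanSpace 𝕜 (Fin n)) 1)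
    (hT : ∀ M S, FactorsThroughEllOne M S → 1 ≤ ‖T - S‖) {δ : ℝ} (hδ : 0 < δ) (hδ' : δ ≤ 1)
    (k : ℕ) :
    ∃ (V : EuclideanSpace 𝕜 (Fin k) →L[𝕜] lp (fun n : ℕ => EuclideanSpace 𝕜 (Fin n)) 1)
      (W : lp (fun n : ℕ => EuclideanSpace 𝕜 (Fin n)) 1 →L[𝕜] EuclideanSpace 𝕜 (Fin k)),
      ‖V‖ ≤ 1 + δ ∧ ‖W‖ ≤ 1 + δ ∧ ∀ x, ‖W (T (V x)) - x‖ ≤ δ * ‖x‖ := by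
  have h4 : 4 * (δ / 4) = δ := by ring
  let I : ∀ k, EuclideanSpace 𝕜 (Fin k) →L[𝕜] lp (fun n : ℕ => EuclideanSpace 𝕜 (Fin n)) 1 :=
    lp.singleContinuousLinearMap 𝕜 _ 1
  have hI : ∀ k, ‖I k‖ ≤ 1 := fun k =>
    ContinuousLinearMap.opNorm_le_bound _ zero_le_one fun x => by simp [I]
  obtain ⟨M, hM⟩ := dichotomy_normalized (𝕜 := 𝕜) (E := fun n : ℕ => EuclideanSpace 𝕜 (Fin n))
    (norm_nonneg T) (δ := δ / 4) (by positivity) (by linarith) k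
  rw [h4] at hM
  have hTI : ∀ n, ‖T ∘L I n‖ ≤ ‖T‖ := fun n =>
    (T.opNorm_comp_le _).trans (mul_le_of_le_one_right (norm_nonneg _) (hI n))
  by_cases h : ∃ n, ∃ (V : EuclideanSpace 𝕜 (Fin k) →L[𝕜] EuclideanSpace 𝕜 (Fin n))
      (W : lp (fun n : ℕ => EuclideanSpace 𝕜 (Fin n)) 1 →L[𝕜] EuclideanSpace 𝕜 (Fin k)),
      ‖V‖ ≤ 1 + δ ∧ ‖W‖ ≤ 1 + δ ∧ ∀ x, ‖W ((T ∘L I n) (V x)) - x‖ ≤ δ * ‖x‖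
  · obtain ⟨n, V, W, hV, hW, hWV⟩ := h
    exact ⟨I n ∘L V, W, ((I n).opNorm_comp_le V).trans
      ((mul_le_of_le_one_left (norm_nonneg _) (hI n)).trans hV), hW, hWV⟩
  · have h1 : ∀ n, ∃ S, FactorsThroughEllOne M S ∧ ‖T ∘L I n - S‖ ≤ 1 - δ / 4 := fun n =>
      (hM n (T ∘L I n) (hTI n)).resolve_right fun h' => h ⟨n, h'⟩
    choose S hS hTS using h1
    have hM0 : 0 ≤ M := (norm_nonneg _).trans (hS 0).norm_le
    obtain ⟨S', -, hS', -⟩ := exists_desc hM0 S fun n => (hS n).norm_le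
    have hS'I : ∀ n, S' ∘L I n = S n := fun n => ContinuousLinearMap.ext fun x => hS' n x
    have h2 := hT M S' (.of_single hM0 S' fun n => (hS'I n).symm ▸ hS n)
    have h3 : ‖T - S'‖ ≤ 1 - δ / 4 := opNorm_le_of_single (by linarith) _ fun n x => by
      have : (T - S') (lp.single 1 n x) = (T ∘L I n - S n) x := by
        rw [← hS'I]; rfl
      rw [this]
      exact (T ∘L I n - S n).le_of_opNorm_le (hTS n) x
    linarith

end Main

end EllOneSum

/-- Let `X = (⊕_{n∈ℕ} ℓ₂ⁿ)_{ℓ₁}` and let `G` denote the operator-norm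
closure in `B(X)` of the set of operators factoring through `ℓ₁`. Then for every `C > 1`
and every `T ∈ B(X)` with `T ∉ G` and `dist(T, G) = 1`, there are `U, V ∈ B(X)` with
`U ∘ T ∘ V = I_X` and `‖U‖·‖V‖ ≤ C`. -/
theorem statement14 {𝕜 : Type*} [RCLike 𝕜] (C : ℝ) (hC : 1 < C)
    (G : Set (lp (fun n : ℕ => EuclideanSpace 𝕜 (Fin n)) 1 →L[𝕜]
              lp (fun n : ℕ => EuclideanSpace 𝕜 (Fin n)) 1))
    (hG : G = closure {T | ∃ (V : lp (fun n : ℕ => EuclideanSpace 𝕜 (Fin n)) 1 →L[𝕜]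
                                lp (fun _ : ℕ => 𝕜) 1)
                           (U : lp (fun _ : ℕ => 𝕜) 1 →L[𝕜]
                                lp (fun n : ℕ => EuclideanSpace 𝕜 (Fin n)) 1),
                        T = U ∘L V})
    (T : lp (fun n : ℕ => EuclideanSpace 𝕜 (Fin n)) 1 →L[𝕜]
         lp (fun n : ℕ => EuclideanSpace 𝕜 (Fin n)) 1)
    (hT : T ∉ G) (hTdist : Metric.infDist T G = 1) :
    ∃ U V : lp (fun n : ℕ => EuclideanSpace 𝕜 (Fin n)) 1 →L[𝕜]
            lp (fun n : ℕ => EuclideanSpace 𝕜 (Fin n)) 1,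
      U ∘L T ∘L V = ContinuousLinearMap.id 𝕜 (lp (fun n : ℕ => EuclideanSpace 𝕜 (Fin n)) 1) ∧
        ‖U‖ * ‖V‖ ≤ C := by
  obtain ⟨δ, hδ, hδ1, hδC⟩ : ∃ δ : ℝ, 0 < δ ∧ δ ≤ 1 / 20 ∧ 1 + 12 * δ ≤ C :=
    ⟨min (1 / 20) ((C - 1) / 12), lt_min (by norm_num) (by linarith), min_le_left _ _, by
      linarith [min_le_right (1 / 20) ((C - 1) / 12)]⟩
  have hdist : ∀ M S, EllOneSum.FactorsThroughEllOne M S → 1 ≤ ‖T - S‖ := by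
    rintro M S ⟨V, U, -, -, rfl⟩
    rw [← hTdist, ← dist_eq_norm, hG]
    exact Metric.infDist_le_dist_of_mem (subset_closure ⟨V, U, rfl⟩)
  obtain ⟨V, U, hV, hU, hUV⟩ := EllOneSum.exists_almost_identity T hδ
    (EllOneSum.exists_euclidean_copy T hdist hδ (by linarith))
  obtain ⟨B, hB, hB'⟩ := EllOneSum.exists_leftInverse_of_norm_sub_id_le (U ∘L T ∘L V)
    (ε := 5 * δ) (by linarith) (hUV.trans (by nlinarith))
  refine ⟨B ∘L U, V, by rw [ContinuousLinearMap.comp_assoc, hB], ?_⟩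
  have h1 : 0 < 1 - 5 * δ := by linarith
  calc ‖B ∘L U‖ * ‖V‖ ≤ ‖B‖ * ‖U‖ * ‖V‖ := by gcongr; exact B.opNorm_comp_le U
    _ ≤ (1 - 5 * δ)⁻¹ * (1 + δ) * (1 + δ) := by gcongr
    _ = (1 + δ) ^ 2 / (1 - 5 * δ) := by ring
    _ ≤ 1 + 12 * δ := by
      rw [div_le_iff₀ h1]
      nlinarith
    _ ≤ C := hδC
end

section
/- Let Γ and Ξ be infinite index sets, let (F_γ)_{γ∈Γ} and (G_ξ)_{ξ∈Ξ} be families of nonzero finite-dimensional normed spaces, and let X = (⊕_{γ∈Γ} F_γ)_{ℓ₁} and Y = (⊕_{ξ∈Ξ} G_ξ)_{ℓ₁} be their ℓ₁-direct sums. Then for every non-compact bounded linear operator T : X → Y with essential norm ‖T‖ₑ = 1 and every constant C > 1, there exist bounded linear operators U : Y → ℓ₁ and V : ℓ₁ → X such that U∘T∘V = I_{ℓ₁} and ‖U‖·‖V‖ ≤ C. -/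
open Filter Topology

namespace lp

section Truncation

variable {ι : Type*} {E : ι → Type*} [∀ i, NormedAddCommGroup (E i)]

/-- The `ℓ₁` norm is the sum of the norm on a finite set of coordinates and off it. -/
theorem norm_eq_sum_add_norm_sub [DecidableEq ι] (y : lp E 1) (A : Finset ι) :
    ‖y‖ = (∑ i ∈ A, ‖y i‖) + ‖y - ∑ i ∈ A, lp.single 1 i (y i)‖ := by
  have h := lp.norm_compl_sum_single (p := 1) (by simp) y A
  simp only [ENNReal.toReal_one, Real.rpow_one] at h
  linarith

variable (𝕜 : Type*) [RCLike 𝕜] [∀ i, NormedSpace 𝕜 (E i)]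

open Classical in
/-- The projection of an `ℓ₁`-sum onto a finite set of coordinates. -/
noncomputable def truncate (A : Finset ι) : lp E 1 →L[𝕜] lp E 1 :=
  ∑ i ∈ A, lp.singleContinuousLinearMap 𝕜 E 1 i ∘L lp.evalCLM 𝕜 E 1 i

open Classical in
theorem truncate_eq_sum (A : Finset ι) (y : lp E 1) :
    truncate 𝕜 A y = ∑ i ∈ A, lp.single 1 i (y i) := by
  simp only [truncate, sum_apply]
  rfl

theorem norm_truncate (A : Finset ι) (y : lp E 1) : ‖truncate 𝕜 A y‖ = ∑ i ∈ A, ‖y i‖ := by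
  classical
  have h := lp.norm_sum_single (p := 1) (by simp) (fun i => y i) A
  simpa only [ENNReal.toReal_one, Real.rpow_one, ← truncate_eq_sum 𝕜] using h

theorem norm_eq_norm_truncate_add (A : Finset ι) (y : lp E 1) :
    ‖y‖ = ‖truncate 𝕜 A y‖ + ‖y - truncate 𝕜 A y‖ := by
  classical
  rw [norm_truncate, truncate_eq_sum]
  exact norm_eq_sum_add_norm_sub y A

theorem norm_truncate_le (A : Finset ι) (y : lp E 1) : ‖truncate 𝕜 A y‖ ≤ ‖y‖ := by
  linarith [norm_eq_norm_truncate_add 𝕜 A y, norm_nonneg (y - truncate 𝕜 A y)]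

theorem norm_truncate_mono {A B : Finset ι} (h : A ⊆ B) (y : lp E 1) :
    ‖truncate 𝕜 A y‖ ≤ ‖truncate 𝕜 B y‖ := by
  simp only [norm_truncate]
  exact Finset.sum_le_sum_of_subset_of_nonneg h fun _ _ _ => norm_nonneg _

open Classical in
theorem truncate_apply (A : Finset ι) (y : lp E 1) (i : ι) :
    truncate 𝕜 A y i = if i ∈ A then y i else 0 := by
  rw [truncate_eq_sum, lp.coeFn_sum, Finset.sum_apply]
  simp only [lp.coeFn_single, Finset.sum_pi_single]

theorem norm_truncate_sub_truncate {A B : Finset ι} (h : A ⊆ B) (y : lp E 1) :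
    ‖truncate 𝕜 B y - truncate 𝕜 A y‖ = ‖truncate 𝕜 B y‖ - ‖truncate 𝕜 A y‖ := by
  classical
  have hAB : truncate 𝕜 A (truncate 𝕜 B y) = truncate 𝕜 A y := by
    ext i
    simp only [truncate_apply]
    split_ifs with h1 h2
    · rfl
    · exact absurd (h h1) h2
    · rfl
  have := norm_eq_norm_truncate_add 𝕜 A (truncate 𝕜 B y)
  rw [hAB] at this
  linarith

theorem tendsto_truncate (y : lp E 1) :
    Tendsto (fun A : Finset ι => truncate 𝕜 A y) atTop (𝓝 y) := by
  classical
  simp only [truncate_eq_sum]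
  exact lp.hasSum_single (by simp) y

theorem exists_norm_sub_truncate_lt (y : lp E 1) {ε : ℝ} (hε : 0 < ε) (A : Finset ι) :
    ∃ B, A ⊆ B ∧ ‖y - truncate 𝕜 B y‖ < ε := by
  have h := (tendsto_truncate 𝕜 y).eventually (Metric.ball_mem_nhds y hε)
  obtain ⟨B, hB, hAB⟩ := (h.and (eventually_ge_atTop A)).exists
  exact ⟨B, hAB, by rwa [← dist_eq_norm, dist_comm]⟩

theorem isCompactOperator_truncate [∀ i, FiniteDimensional 𝕜 (E i)] (A : Finset ι) :
    IsCompactOperator (truncate 𝕜 A : lp E 1 →L[𝕜] lp E 1) := by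
  classical
  have key (i : ι) : IsCompactOperator
      (lp.singleContinuousLinearMap 𝕜 E 1 i ∘L lp.evalCLM 𝕜 E 1 i) := by
    have : ProperSpace (E i) := FiniteDimensional.proper 𝕜 (E i)
    have h := isCompactOperator_of_locallyCompactSpace_dom
      (lp.evalCLM 𝕜 E 1 i)
    exact h.clm_comp (lp.singleContinuousLinearMap 𝕜 E 1 i)
  exact Submodule.sum_mem (compactOperator (RingHom.id 𝕜) (lp E 1) (lp E 1)) fun i _ => key i

/-- A bounded family in an `ℓ₁`-sum of finite-dimensional spaces converges coordinatewise along
every ultrafilter. -/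
theorem exists_tendsto_truncate_sub [∀ i, FiniteDimensional 𝕜 (E i)] {κ : Type*}
    (𝒰 : Ultrafilter κ) (y : κ → lp E 1) {M : ℝ} (hM : ∀ k, ‖y k‖ ≤ M) :
    ∃ z : lp E 1, ∀ A, Tendsto (fun k => ‖truncate 𝕜 A (y k - z)‖) 𝒰 (𝓝 0) := by
  have hz (i : ι) : ∃ z : E i, Tendsto (fun k => y k i) 𝒰 (𝓝 z) := by
    have : ProperSpace (E i) := FiniteDimensional.proper 𝕜 (E i)
    obtain ⟨z, -, hz⟩ := (isCompact_closedBall (0 : E i) M).ultrafilter_le_nhds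
      (𝒰.map fun k => y k i) (by
        simp only [Ultrafilter.coe_map, le_principal_iff, mem_map]
        refine univ_mem' fun k => ?_
        simpa using (lp.norm_apply_le_norm one_ne_zero (y k) i).trans (hM k))
    exact ⟨z, hz⟩
  choose z hz using hz
  have hmem : Memℓp z 1 := by
    refine lp.memℓp_of_tendsto (l := (𝒰 : Filter κ)) (F := y) ?_ (tendsto_pi_nhds.2 hz)
    exact isBounded_iff_forall_norm_le.2 ⟨M, Set.forall_mem_range.2 hM⟩
  refine ⟨⟨z, hmem⟩, fun A => ?_⟩
  simp only [norm_truncate]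
  rw [← Finset.sum_const_zero (s := A)]
  refine tendsto_finsetSum A fun i _ => ?_
  exact tendsto_iff_norm_sub_tendsto_zero.1 (hz i)

end Truncation

section Lift

variable {𝕜 : Type*} [RCLike 𝕜] {E : Type*} [NormedAddCommGroup E] [NormedSpace 𝕜 E]

theorem hasSum_norm_one (a : lp (fun _ : ℕ => 𝕜) 1) : HasSum (fun k => ‖a k‖) ‖a‖ := by
  simpa using lp.hasSum_norm (p := 1) (by simp) a

theorem hasSum_smul_single (a : lp (fun _ : ℕ => 𝕜) 1) :
    HasSum (fun k => a k • (lp.single 1 k 1 : lp (fun _ : ℕ => 𝕜) 1)) a := by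
  simpa [← lp.single_smul] using lp.hasSum_single (p := 1) (by simp) a

/-- An operator on `ℓ₁` is bounded by its values on the unit vectors. -/
theorem opNorm_le_of_norm_single_le (S : lp (fun _ : ℕ => 𝕜) 1 →L[𝕜] E) {M : ℝ} (hM : 0 ≤ M)
    (h : ∀ k, ‖S (lp.single 1 k 1)‖ ≤ M) : ‖S‖ ≤ M := by
  refine S.opNorm_le_bound hM fun a => ?_
  have hS := (hasSum_smul_single a).map S S.continuous
  refine hS.norm_le_of_bounded ((hasSum_norm_one a).mul_left M) fun k => ?_
  simp only [Function.comp_apply, map_smul, norm_smul]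
  rw [mul_comm]
  exact mul_le_mul_of_nonneg_right (h k) (norm_nonneg _)

/-- A bounded sequence in a Banach space is the image of the unit vectors of `ℓ₁` under an
operator. -/
theorem exists_clm_single_eq [CompleteSpace E] (v : ℕ → E) {M : ℝ} (hM : ∀ k, ‖v k‖ ≤ M) :
    ∃ V : lp (fun _ : ℕ => 𝕜) 1 →L[𝕜] E, (∀ k, V (lp.single 1 k 1) = v k) ∧ ‖V‖ ≤ M := by
  have hle (a : lp (fun _ : ℕ => 𝕜) 1) (k : ℕ) : ‖a k • v k‖ ≤ M * ‖a k‖ := by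
    rw [norm_smul, mul_comm]
    exact mul_le_mul_of_nonneg_right (hM k) (norm_nonneg _)
  have hs (a : lp (fun _ : ℕ => 𝕜) 1) : Summable fun k => a k • v k :=
    .of_norm_bounded ((hasSum_norm_one a).summable.mul_left M) (hle a)
  have hM0 : 0 ≤ M := (norm_nonneg _).trans (hM 0)
  let L : lp (fun _ : ℕ => 𝕜) 1 →ₗ[𝕜] E :=
    { toFun a := ∑' k, a k • v k
      map_add' a b := by
        rw [← (hs a).tsum_add (hs b)]
        simp [add_smul]
      map_smul' c a := by
        rw [RingHom.id_apply, ← (hs a).tsum_const_smul]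
        simp [mul_smul] }
  have hL (a) : ‖L a‖ ≤ M * ‖a‖ :=
    (hs a).hasSum.norm_le_of_bounded ((hasSum_norm_one a).mul_left M) (hle a)
  refine ⟨L.mkContinuous M hL, fun k => ?_, L.mkContinuous_norm_le hM0 hL⟩
  change ∑' j, (lp.single 1 k 1 : lp (fun _ : ℕ => 𝕜) 1) j • v j = v k
  rw [tsum_eq_single k]
  · simp
  · intro j hj
    simp [hj]

/-- A sequence of functionals with absolutely summable values defines an operator into `ℓ₁`. -/
theorem exists_clm_apply_eq (g : ℕ → E →L[𝕜] 𝕜)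
    (hg : ∀ N y, ∑ k ∈ Finset.range N, ‖g k y‖ ≤ ‖y‖) :
    ∃ U : E →L[𝕜] lp (fun _ : ℕ => 𝕜) 1, (∀ y k, U y k = g k y) ∧ ‖U‖ ≤ 1 := by
  have hfin (y : E) (s : Finset ℕ) : ∑ k ∈ s, ‖g k y‖ ≤ ‖y‖ := by
    obtain ⟨N, hN⟩ := s.exists_nat_subset_range
    exact (Finset.sum_le_sum_of_subset_of_nonneg hN fun _ _ _ => norm_nonneg _).trans (hg N y)
  have hmem (y : E) : Memℓp (fun k => g k y) 1 := by
    refine memℓp_gen' (C := ‖y‖) fun s => ?_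
    simpa using hfin y s
  let L : E →ₗ[𝕜] lp (fun _ : ℕ => 𝕜) 1 :=
    { toFun y := ⟨fun k => g k y, hmem y⟩
      map_add' a b := by
        ext k
        exact map_add (g k) a b
      map_smul' c a := by
        ext k
        exact map_smul (g k) c a }
  have hL (y) : ‖L y‖ ≤ 1 * ‖y‖ := by
    rw [one_mul]
    refine lp.norm_le_of_forall_sum_le (by simp) (norm_nonneg y) fun s => ?_
    simpa using! hfin y s
  exact ⟨L.mkContinuous 1 hL, fun y k => rfl, L.mkContinuous_norm_le zero_le_one hL⟩

end Lift

section FactorIdentity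

variable {𝕜 : Type*} [RCLike 𝕜]
  {E : Type*} [NormedAddCommGroup E] [NormedSpace 𝕜 E]
  {ι : Type*} {G : ι → Type*} [∀ i, NormedAddCommGroup (G i)] [∀ i, NormedSpace 𝕜 (G i)]

/-- If `T` stays at distance at least one from the compact operators, then some contractive vectors
have images of norm almost one which are almost supported off a given finite set. -/
theorem exists_norm_truncate_lt [∀ i, FiniteDimensional 𝕜 (G i)] (T : E →L[𝕜] lp G 1)
    (hT : ∀ S : E →L[𝕜] lp G 1, IsCompactOperator S → 1 ≤ ‖T - S‖)
    {δ : ℝ} (hδ : 0 < δ) (A : Finset ι) :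
    ∃ v : E, ‖v‖ ≤ 1 ∧ ‖truncate 𝕜 A (T v)‖ < δ ∧ 1 - δ < ‖T v‖ := by
  set ε := δ / 4 with hε
  have hε0 : 0 < ε := by positivity
  have hx (B : Finset ι) : ∃ x : E, ‖x‖ < 1 ∧ 1 - ε < ‖T x - truncate 𝕜 B (T x)‖ := by
    have h1 := hT (truncate 𝕜 B ∘L T) ((isCompactOperator_truncate 𝕜 B).comp_clm T)
    exact (T - truncate 𝕜 B ∘L T).exists_lt_apply_of_lt_opNorm (by linarith)
  choose x hx1 hx2 using hx
  let 𝒰 : Ultrafilter (Finset ι) := Ultrafilter.of atTop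
  have h𝒰 : (𝒰 : Filter (Finset ι)) ≤ atTop := Ultrafilter.of_le atTop
  obtain ⟨z, hz⟩ := exists_tendsto_truncate_sub 𝕜 𝒰 (fun B => T (x B)) (M := ‖T‖)
    fun B => T.unit_le_opNorm _ (hx1 B).le
  have hlarge : ∀ᶠ B in 𝒰, 1 - 2 * ε < ‖T (x B) - z‖ := by
    have h := h𝒰 ((tendsto_truncate 𝕜 z).eventually (Metric.ball_mem_nhds z hε0))
    filter_upwards [h] with B hB
    rw [dist_comm, dist_eq_norm] at hB
    have h1 := norm_eq_norm_truncate_add 𝕜 B (T (x B) - z)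
    have h2 : T (x B) - truncate 𝕜 B (T (x B)) =
        (T (x B) - z - truncate 𝕜 B (T (x B) - z)) + (z - truncate 𝕜 B z) := by
      rw [map_sub]; abel
    have h3 := hx2 B
    rw [h2] at h3
    have h4 := norm_add_le (T (x B) - z - truncate 𝕜 B (T (x B) - z)) (z - truncate 𝕜 B z)
    linarith [norm_nonneg (truncate 𝕜 B (T (x B) - z))]
  have hpick (B : Finset ι) :
      ∃ k, 1 - 2 * ε < ‖T (x k) - z‖ ∧ ‖truncate 𝕜 B (T (x k) - z)‖ < ε :=
    (hlarge.and ((hz B).eventually_lt_const hε0)).exists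
  obtain ⟨n, hn1, hn2⟩ := hpick A
  obtain ⟨B, hAB, hB⟩ := exists_norm_sub_truncate_lt 𝕜 (T (x n) - z) hε0 A
  obtain ⟨m, hm1, hm2⟩ := hpick B
  set u := T (x n) - z with hu
  set w := T (x m) - z with hw
  have hT2 : T ((2⁻¹ : 𝕜) • (x n - x m)) = (2⁻¹ : 𝕜) • (u - w) := by
    rw [map_smul, map_sub, hu, hw]
    congr 1
    abel
  have hhalf : ‖(2⁻¹ : 𝕜)‖ = 2⁻¹ := by simp
  refine ⟨(2⁻¹ : 𝕜) • (x n - x m), ?_, ?_, ?_⟩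
  · rw [norm_smul, hhalf]
    linarith [norm_sub_le (x n) (x m), hx1 n, hx1 m]
  · rw [hT2, map_smul, norm_smul, hhalf, map_sub]
    linarith [norm_sub_le (truncate 𝕜 A u) (truncate 𝕜 A w), norm_truncate_mono 𝕜 hAB w]
  · rw [hT2, norm_smul, hhalf]
    have h1 := norm_eq_norm_truncate_add 𝕜 B (u - w)
    have h2 := norm_eq_norm_truncate_add 𝕜 B u
    have h3 := norm_eq_norm_truncate_add 𝕜 B w
    have h4 := norm_sub_norm_le (truncate 𝕜 B u) (truncate 𝕜 B w)
    have h5 := norm_sub_norm_le (w - truncate 𝕜 B w) (u - truncate 𝕜 B u)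
    have h6 : u - w - truncate 𝕜 B (u - w) =
        -((w - truncate 𝕜 B w) - (u - truncate 𝕜 B u)) := by
      rw [map_sub]; abel
    rw [h6, _root_.norm_neg, map_sub] at h1
    linarith

/-- Gliding hump: contractive vectors whose images are almost supported on successive blocks. -/
theorem exists_blocks (T : E →L[𝕜] lp G 1) {δ : ℝ} (hδ : 0 < δ)
    (h : ∀ A, ∃ v : E, ‖v‖ ≤ 1 ∧ ‖truncate 𝕜 A (T v)‖ < δ ∧ 1 - δ < ‖T v‖) :
    ∃ (A : ℕ → Finset ι) (v : ℕ → E), Monotone A ∧ ∀ k, ‖v k‖ ≤ 1 ∧ 1 - δ < ‖T (v k)‖ ∧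
      ‖T (v k)‖ - ‖truncate 𝕜 (A (k + 1)) (T (v k)) - truncate 𝕜 (A k) (T (v k))‖ < 2 * δ := by
  choose v hv1 hv2 hv3 using h
  choose next hsub hnext using fun A => exists_norm_sub_truncate_lt 𝕜 (T (v A)) hδ A
  let A : ℕ → Finset ι := fun k => next^[k] ∅
  have hA (k : ℕ) : A (k + 1) = next (A k) := Function.iterate_succ_apply' next k ∅
  refine ⟨A, fun k => v (A k), monotone_nat_of_le_succ fun k => ?_, fun k =>
    ⟨hv1 _, hv3 _, ?_⟩⟩
  · rw [hA]
    exact hsub _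
  · rw [hA, norm_truncate_sub_truncate 𝕜 (hsub _)]
    have := norm_eq_norm_truncate_add 𝕜 (next (A k)) (T (v (A k)))
    linarith [hnext (A k), hv2 (A k)]

/-- An operator on `ℓ₁` close to the identity on unit vectors has a left inverse of small norm. -/
theorem exists_left_inverse (S : lp (fun _ : ℕ => 𝕜) 1 →L[𝕜] lp (fun _ : ℕ => 𝕜) 1) {r : ℝ}
    (hr : r < 1) (hS : ∀ k, ‖lp.single 1 k 1 - S (lp.single 1 k 1)‖ ≤ r) :
    ∃ R : lp (fun _ : ℕ => 𝕜) 1 →L[𝕜] lp (fun _ : ℕ => 𝕜) 1,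
      R ∘L S = ContinuousLinearMap.id 𝕜 _ ∧ ‖R‖ ≤ (1 - r)⁻¹ := by
  set t := 1 - S with ht
  have ht1 : ‖t‖ ≤ r := opNorm_le_of_norm_single_le t ((norm_nonneg _).trans (hS 0)) hS
  have ht2 : ‖t‖ < 1 := ht1.trans_lt hr
  refine ⟨∑' n : ℕ, t ^ n, ?_, ?_⟩
  · have := geom_series_mul_neg t ht2
    rwa [ht, sub_sub_cancel] at this
  · refine (tsum_geometric_le_of_norm_lt_one t ht2).trans ?_
    have h1 : ‖(1 : lp (fun _ : ℕ => 𝕜) 1 →L[𝕜] lp (fun _ : ℕ => 𝕜) 1)‖ ≤ 1 :=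
      ContinuousLinearMap.norm_id_le
    have h2 : (1 - ‖t‖)⁻¹ ≤ (1 - r)⁻¹ := inv_anti₀ (by linarith) (by linarith)
    linarith

/-- An operator sending contractive vectors close to norm-almost-one blocks factors the identity
of `ℓ₁`. -/
theorem exists_factor_of_blocks [CompleteSpace E] (T : E →L[𝕜] lp G 1) {δ : ℝ} (hδ : 0 < δ)
    (hδ5 : 5 * δ < 1) (A : ℕ → Finset ι) (v : ℕ → E) (hA : Monotone A)
    (h : ∀ k, ‖v k‖ ≤ 1 ∧ 1 - δ < ‖T (v k)‖ ∧
      ‖T (v k)‖ - ‖truncate 𝕜 (A (k + 1)) (T (v k)) - truncate 𝕜 (A k) (T (v k))‖ < 2 * δ) :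
    ∃ (U : lp G 1 →L[𝕜] lp (fun _ : ℕ => 𝕜) 1) (V : lp (fun _ : ℕ => 𝕜) 1 →L[𝕜] E),
      U ∘L T ∘L V = ContinuousLinearMap.id 𝕜 (lp (fun _ : ℕ => 𝕜) 1) ∧
      ‖U‖ * ‖V‖ ≤ (1 - 5 * δ)⁻¹ := by
  let P : ℕ → lp G 1 →L[𝕜] lp G 1 := fun k => truncate 𝕜 (A (k + 1)) - truncate 𝕜 (A k)
  set c : ℕ → ℝ := fun k => ‖P k (T (v k))‖ with hc
  have hc1 (k : ℕ) : ‖T (v k)‖ - c k < 2 * δ := (h k).2.2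
  have hc0 (k : ℕ) : 1 - 3 * δ < c k := by linarith [hc1 k, (h k).2.1]
  have hcpos (k : ℕ) : 0 < c k := by linarith [hc0 k]
  choose f hf1 hf2 using fun k => exists_dual_vector'' 𝕜 (P k (T (v k)))
  obtain ⟨U, hU, hU1⟩ := exists_clm_apply_eq (fun k => f k ∘L P k) fun N y => by
    calc ∑ k ∈ Finset.range N, ‖f k (P k y)‖
        ≤ ∑ k ∈ Finset.range N, (‖truncate 𝕜 (A (k + 1)) y‖ - ‖truncate 𝕜 (A k) y‖) := by
          refine Finset.sum_le_sum fun k _ => ?_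
          rw [← norm_truncate_sub_truncate 𝕜 (hA k.le_succ)]
          exact ((f k).le_of_opNorm_le (hf1 k) _).trans (one_mul _).le
      _ ≤ ‖y‖ := by
          rw [Finset.sum_range_sub fun k => ‖truncate 𝕜 (A k) y‖]
          linarith [norm_truncate_le 𝕜 (A N) y, norm_nonneg (truncate 𝕜 (A 0) y)]
  have hnorm (k : ℕ) : ‖((c k)⁻¹ : 𝕜)‖ = (c k)⁻¹ := by
    rw [norm_inv, RCLike.norm_ofReal, abs_of_pos (hcpos k)]
  obtain ⟨V, hV, hV1⟩ := exists_clm_single_eq (𝕜 := 𝕜) (fun k => ((c k)⁻¹ : 𝕜) • v k)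
    (M := (1 - 3 * δ)⁻¹) fun k => by
      rw [norm_smul, hnorm]
      calc (c k)⁻¹ * ‖v k‖ ≤ (c k)⁻¹ * 1 :=
            mul_le_mul_of_nonneg_left (h k).1 (inv_nonneg.2 (hcpos k).le)
        _ ≤ (1 - 3 * δ)⁻¹ := by
            rw [mul_one]
            exact inv_anti₀ (by linarith) (hc0 k).le
  have hclose (k : ℕ) : ‖lp.single 1 k 1 - (U ∘L T ∘L V) (lp.single 1 k 1)‖ ≤
      2 * δ * (1 - 3 * δ)⁻¹ := by
    have hdiag : U (T (v k)) k = (c k : 𝕜) := (hU _ k).trans (hf2 k)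
    have h1 := norm_eq_sum_add_norm_sub (U (T (v k))) {k}
    rw [Finset.sum_singleton, Finset.sum_singleton, hdiag, RCLike.norm_ofReal,
      abs_of_pos (hcpos k)] at h1
    have h2 : ‖U (T (v k))‖ ≤ ‖T (v k)‖ := (U.le_of_opNorm_le hU1 _).trans (one_mul _).le
    have h3 : lp.single 1 k 1 - (U ∘L T ∘L V) (lp.single 1 k 1) =
        -(((c k)⁻¹ : 𝕜) • (U (T (v k)) - lp.single 1 k (c k : 𝕜))) := by
      have hne : (c k : 𝕜) ≠ 0 := RCLike.ofReal_ne_zero.2 (hcpos k).ne'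
      rw [smul_sub, ← lp.single_smul, smul_eq_mul, inv_mul_cancel₀ hne]
      simp [hV]
    rw [h3, _root_.norm_neg, norm_smul, hnorm, mul_comm]
    exact mul_le_mul (by linarith [hc1 k]) (inv_anti₀ (by linarith) (hc0 k).le)
      (inv_nonneg.2 (hcpos k).le) (by linarith)
  have h3 : 0 < 1 - 3 * δ := by linarith
  have h5 : 0 < 1 - 5 * δ := by linarith
  have heq : 1 - 2 * δ * (1 - 3 * δ)⁻¹ = (1 - 5 * δ) * (1 - 3 * δ)⁻¹ := by
    have := mul_inv_cancel₀ h3.ne'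
    linear_combination -this
  have hlt : 2 * δ * (1 - 3 * δ)⁻¹ < 1 := by
    have := mul_pos h5 (inv_pos.2 h3)
    linarith
  obtain ⟨R, hR, hR1⟩ := exists_left_inverse (U ∘L T ∘L V) hlt hclose
  refine ⟨R ∘L U, V, hR, ?_⟩
  have hRU : ‖R ∘L U‖ ≤ (1 - 2 * δ * (1 - 3 * δ)⁻¹)⁻¹ := by
    refine (R.opNorm_comp_le U).trans ?_
    calc ‖R‖ * ‖U‖ ≤ ‖R‖ * 1 := mul_le_mul_of_nonneg_left hU1 (norm_nonneg _)
      _ ≤ _ := by rwa [mul_one]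
  calc ‖R ∘L U‖ * ‖V‖ ≤ (1 - 2 * δ * (1 - 3 * δ)⁻¹)⁻¹ * (1 - 3 * δ)⁻¹ :=
        mul_le_mul hRU hV1 (norm_nonneg _) ((norm_nonneg _).trans hRU)
    _ = (1 - 5 * δ)⁻¹ := by
        rw [heq, mul_inv, inv_inv, mul_assoc, mul_inv_cancel₀ h3.ne', mul_one]

end FactorIdentity

end lp


open scoped ENNReal

/-- Let `Γ`, `Ξ` be infinite index sets, `(F_γ)` and `(G_ξ)` families of
nonzero finite-dimensional normed spaces, and `X = (⊕ F_γ)_{ℓ₁}`, `Y = (⊕ G_ξ)_{ℓ₁}`.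
Then for every non-compact operator `T : X → Y` with essential norm one and every `C > 1`,
there are operators `U : Y → ℓ₁` and `V : ℓ₁ → X` with `U ∘ T ∘ V = I_{ℓ₁}` and
`‖U‖·‖V‖ ≤ C`. -/
theorem statement16 {𝕜 : Type*} [RCLike 𝕜]
    {Γ : Type*} [Infinite Γ] {Ξ : Type*} [Infinite Ξ]
    (F : Γ → Type*) [∀ γ, NormedAddCommGroup (F γ)] [∀ γ, NormedSpace 𝕜 (F γ)]
    [∀ γ, FiniteDimensional 𝕜 (F γ)] [∀ γ, Nontrivial (F γ)]
    (G : Ξ → Type*) [∀ ξ, NormedAddCommGroup (G ξ)] [∀ ξ, NormedSpace 𝕜 (G ξ)]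
    [∀ ξ, FiniteDimensional 𝕜 (G ξ)] [∀ ξ, Nontrivial (G ξ)]
    (T : lp F 1 →L[𝕜] lp G 1) (hT : ¬IsCompactOperator ⇑T)
    (hTe : Metric.infDist T {S : lp F 1 →L[𝕜] lp G 1 | IsCompactOperator ⇑S} = 1)
    (C : ℝ) (hC : 1 < C) :
    ∃ (U : lp G 1 →L[𝕜] lp (fun _ : ℕ => 𝕜) 1) (V : lp (fun _ : ℕ => 𝕜) 1 →L[𝕜] lp F 1),
      U ∘L T ∘L V = ContinuousLinearMap.id 𝕜 (lp (fun _ : ℕ => 𝕜) 1) ∧ ‖U‖ * ‖V‖ ≤ C := by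
  have hdist (S : lp F 1 →L[𝕜] lp G 1) (hS : IsCompactOperator S) : 1 ≤ ‖T - S‖ := by
    rw [← hTe, ← dist_eq_norm]
    exact Metric.infDist_le_dist_of_mem hS
  have hC0 : 0 < C := by linarith
  have hCinv : C⁻¹ < 1 := inv_lt_one_of_one_lt₀ hC
  set δ : ℝ := (1 - C⁻¹) / 5 with hδ
  have hδ0 : 0 < δ := by linarith
  have h5 : 1 - 5 * δ = C⁻¹ := by
    rw [hδ]
    ring
  have (γ : Γ) : CompleteSpace (F γ) := FiniteDimensional.complete 𝕜 (F γ)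
  obtain ⟨A, v, hA, hAv⟩ := lp.exists_blocks T hδ0 (lp.exists_norm_truncate_lt T hdist hδ0)
  obtain ⟨U, V, hUV, hle⟩ := lp.exists_factor_of_blocks T hδ0
    (by linarith [inv_pos.2 hC0]) A v hA hAv
  rw [h5, inv_inv] at hle
  exact ⟨U, V, hUV, hle⟩
end
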